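/- arXiv:2106.10863 — 6 statements merged into one kernel-verified Lean document; each statement's English description precedes it below -/
import Mathlib

section
/- Let T be a finite tree (a connected acyclic simple graph) and r ≥ 1. Then the r-independence complex Ind_r(T) is shellable: there is a linear ordering F₁, F₂, …, F_t of the facets (maximal faces) of Ind_r(T) such that for every k with 2 ≤ k ≤ t, the simplicial complex (⋃_{j<k} Δ^{F_j}) ∩ Δ^{F_k} is pure of dimension |F_k| − 2, i.e., every maximal element of { F' ⊆ F_k : F' ⊆ F_j for some j < k } has cardinality |F_k| − 1. -/
/-- A set `A` of vertices is `r`-independent in `G` if every connected component of the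
induced subgraph `G[A]` has at most `r` vertices. -/
def rIndep {V : Type*} (G : SimpleGraph V) (r : ℕ) (A : Set V) : Prop :=
  ∀ c : (G.induce A).ConnectedComponent, c.supp.ncard ≤ r

/-- A facet of the `r`-independence complex `Ind_r(G)`: a maximal `r`-independent set. -/
def IsIndFacet {V : Type*} (G : SimpleGraph V) (r : ℕ) (A : Finset V) : Prop :=
  rIndep G r ↑A ∧ ∀ B : Finset V, rIndep G r ↑B → A ⊆ B → A = B

open Relation in
open Classical in
/-- The finite set of elements reachable from `x` along the relation `R`. -/
noncomputable def reachSet {V : Type*} [Fintype V] (R : V → V → Prop) (x : V) : Finset V :=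
  Finset.univ.filter (ReflTransGen R x)

/-- The component of `x` in the subgraph of `G` induced on `S` (it is `{x}` if `x ∉ S`). -/
noncomputable def componentIn {V : Type*} [Fintype V] (G : SimpleGraph V) (S : Finset V) (x : V) :
    Finset V :=
  reachSet (fun a b ↦ a ∈ S ∧ b ∈ S ∧ G.Adj a b) x

/-- The vertices reachable from `x` inside `U` along edges that increase the depth `d`. -/
noncomputable def descIn {V : Type*} [Fintype V] (G : SimpleGraph V) (d : V → ℕ) (U : Finset V)
    (x : V) : Finset V :=
  reachSet (fun a b ↦ b ∈ U ∧ G.Adj a b ∧ d a < d b) x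

/-- Every component of the subgraph induced on `S` has at most `r` vertices. -/
def SmallComponents {V : Type*} [Fintype V] (G : SimpleGraph V) (r : ℕ) (S : Finset V) : Prop :=
  ∀ x ∈ S, (componentIn G S x).card ≤ r

/-- `d` behaves like the distance to a root of a forest: adjacent vertices have different depths,
and each vertex has at most one neighbour of smaller depth. -/
structure IsDepth {V : Type*} (G : SimpleGraph V) (d : V → ℕ) : Prop where
  ne_of_adj : ∀ {x y}, G.Adj x y → d x ≠ d y
  parent_unique : ∀ {x y z}, G.Adj y x → G.Adj z x → d y < d x → d z < d x → y = z

/-- `S` is maximal among the sets between `A` and `U` all of whose components are small. -/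
def IsFacetBetween {V : Type*} [Fintype V] (G : SimpleGraph V) (r : ℕ) (A U S : Finset V) : Prop :=
  A ⊆ S ∧ S ⊆ U ∧ SmallComponents G r S ∧ ∀ B, S ⊆ B → B ⊆ U → SmallComponents G r B → B ⊆ S

/-- A shelling, listed from the last set to the first. -/
def IsRevShelling {V : Type*} [DecidableEq V] : List (Finset V) → Prop
  | [] => True
  | F :: L => IsRevShelling L ∧ ∀ E ∈ L, ∃ H ∈ L, ∃ x ∈ F, x ∉ E ∧ F.erase x ⊆ H

section Reach

variable {V : Type*} [Fintype V]

theorem mem_reachSet {R : V → V → Prop} {x y : V} :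
    y ∈ reachSet R x ↔ Relation.ReflTransGen R x y := by
  simp [reachSet]

theorem self_mem_reachSet (R : V → V → Prop) (x : V) : x ∈ reachSet R x :=
  mem_reachSet.2 .refl

theorem reachSet_step {R : V → V → Prop} {x a b : V} (ha : a ∈ reachSet R x) (hab : R a b) :
    b ∈ reachSet R x :=
  mem_reachSet.2 ((mem_reachSet.1 ha).tail hab)

theorem reachSet_subset {R : V → V → Prop} {x : V} {M : Finset V} (hx : x ∈ M)
    (hM : ∀ a ∈ M, ∀ b, R a b → b ∈ M) : reachSet R x ⊆ M := by
  intro y hy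
  induction mem_reachSet.1 hy with
  | refl => exact hx
  | tail hab hbc ih => exact hM _ (ih (mem_reachSet.2 hab)) _ hbc

variable {G : SimpleGraph V} {d : V → ℕ} {r : ℕ}

theorem componentIn_subset {S : Finset V} {x : V} (hx : x ∈ S) : componentIn G S x ⊆ S :=
  reachSet_subset hx fun _ _ _ h ↦ h.2.1

theorem componentIn_mono {S S' : Finset V} (h : S ⊆ S') (x : V) :
    componentIn G S x ⊆ componentIn G S' x :=
  reachSet_subset (self_mem_reachSet _ _) fun _ ha _ hab ↦
    reachSet_step ha ⟨h hab.1, h hab.2.1, hab.2.2⟩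

theorem componentIn_symm {S : Finset V} {x y : V} (h : y ∈ componentIn G S x) :
    x ∈ componentIn G S y := by
  have : Std.Symm (fun a b ↦ a ∈ S ∧ b ∈ S ∧ G.Adj a b) := ⟨fun _ _ h ↦ ⟨h.2.1, h.1, h.2.2.symm⟩⟩
  exact mem_reachSet.2 (Relation.ReflTransGen.stdSymm.symm _ _ (mem_reachSet.1 h))

theorem componentIn_subset_of_mem {S : Finset V} {x y : V} (h : y ∈ componentIn G S x) :
    componentIn G S y ⊆ componentIn G S x :=
  reachSet_subset h fun _ ha _ hab ↦ reachSet_step ha hab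

theorem SmallComponents.mono {S S' : Finset V} (hS : SmallComponents G r S') (h : S ⊆ S') :
    SmallComponents G r S := fun x hx ↦
  (Finset.card_le_card (componentIn_mono h x)).trans (hS x (h hx))

theorem SmallComponents.union [DecidableEq V] {F E M : Finset V} (hF : SmallComponents G r F)
    (hEM : E ⊆ M) (hM : ∀ a ∈ M, ∀ b ∈ F ∪ E, G.Adj a b → b ∈ M) (hr : M.card ≤ r) :
    SmallComponents G r (F ∪ E) := by
  intro x hx
  by_cases hxM : x ∈ M
  · exact (Finset.card_le_card (reachSet_subset hxM fun a ha b h ↦ hM a ha b h.2.1 h.2.2)).trans hr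
  · have hmem : ∀ y ∈ F ∪ E, y ∉ M → y ∈ F := fun y hy hyM ↦
      (Finset.mem_union.1 hy).resolve_right fun h ↦ hyM (hEM h)
    refine (Finset.card_le_card ?_).trans (hF x (hmem x hx hxM))
    have : componentIn G (F ∪ E) x ⊆ componentIn G F x \ M := by
      refine reachSet_subset (Finset.mem_sdiff.2 ⟨self_mem_reachSet _ _, hxM⟩) ?_
      rintro a ha b ⟨haS, hbS, hab⟩
      obtain ⟨ha, haM⟩ := Finset.mem_sdiff.1 ha
      have hbM : b ∉ M := fun hb ↦ haM (hM b hb a haS hab.symm)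
      exact Finset.mem_sdiff.2 ⟨reachSet_step ha ⟨hmem a haS haM, hmem b hbS hbM, hab⟩, hbM⟩
    exact this.trans Finset.sdiff_subset

theorem descIn_subset {U : Finset V} {x : V} (hx : x ∈ U) : descIn G d U x ⊆ U :=
  reachSet_subset hx fun _ _ _ h ↦ h.1

theorem depth_le_of_mem_descIn {U : Finset V} {x y : V} (h : y ∈ descIn G d U x) : d x ≤ d y := by
  have : descIn G d U x ⊆ Finset.univ.filter (fun y ↦ d x ≤ d y) :=
    reachSet_subset (by simp) fun a ha b hab ↦ by
      have := hab.2.2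
      simp only [Finset.mem_filter, Finset.mem_univ, true_and] at ha ⊢
      omega
  simpa using this h

theorem descIn_step {U : Finset V} {x a b : V} (ha : a ∈ descIn G d U x) (hb : b ∈ U)
    (hab : G.Adj a b) (hd : d a < d b) : b ∈ descIn G d U x :=
  reachSet_step ha ⟨hb, hab, hd⟩

theorem IsDepth.mem_descIn_of_adj (h : IsDepth G d) {U : Finset V} {x a b : V}
    (ha : a ∈ descIn G d U x) (hax : a ≠ x) (hb : b ∈ U) (hab : G.Adj a b) :
    b ∈ descIn G d U x := by
  rcases lt_or_gt_of_ne (h.ne_of_adj hab) with hlt | hlt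
  · exact descIn_step ha hb hab hlt
  · rcases Relation.ReflTransGen.cases_tail (mem_reachSet.1 ha) with h0 | ⟨c, hc, -, hca, hlt'⟩
    · exact absurd h0 hax
    · rw [h.parent_unique hab.symm hca hlt hlt']
      exact mem_reachSet.2 hc

theorem descIn_subset_componentIn {U S : Finset V} {x : V} (h : descIn G d U x ⊆ S) :
    descIn G d U x ⊆ componentIn G S x := by
  classical
  have : descIn G d U x ⊆ componentIn G S x ∩ descIn G d U x := by
    refine reachSet_subset (Finset.mem_inter.2 ⟨self_mem_reachSet _ _, self_mem_reachSet _ _⟩) ?_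
    intro a ha b hab
    obtain ⟨ha, ha'⟩ := Finset.mem_inter.1 ha
    have hb : b ∈ descIn G d U x := reachSet_step ha' hab
    exact Finset.mem_inter.2 ⟨reachSet_step ha ⟨h ha', h hb, hab.2.1⟩, hb⟩
  exact this.trans Finset.inter_subset_left

theorem IsDepth.smallComponents (h : IsDepth G d) {U : Finset V}
    (hU : ∀ v ∈ U, (descIn G d U v).card ≤ r) : SmallComponents G r U := by
  intro x hx
  obtain ⟨y, hy, hmin⟩ := (componentIn G U x).exists_min_image d ⟨x, self_mem_reachSet _ _⟩
  have hyU := componentIn_subset hx hy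
  refine (Finset.card_le_card ?_).trans (hU y hyU)
  refine (componentIn_subset_of_mem (componentIn_symm hy)).trans ?_
  classical
  have : componentIn G U y ⊆ descIn G d U y ∩ componentIn G U x := by
    refine reachSet_subset (Finset.mem_inter.2 ⟨self_mem_reachSet _ _, hy⟩) ?_
    rintro a ha b hab
    obtain ⟨ha, ha'⟩ := Finset.mem_inter.1 ha
    have hb : b ∈ componentIn G U x := reachSet_step ha' hab
    refine Finset.mem_inter.2 ⟨?_, hb⟩
    by_cases hay : a = y
    · subst hay
      exact descIn_step ha hab.2.1 hab.2.2 (lt_of_le_of_ne (hmin b hb) (h.ne_of_adj hab.2.2))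
    · exact h.mem_descIn_of_adj ha hay hab.2.1 hab.2.2
  exact this.trans Finset.inter_subset_left

variable [DecidableEq V]

theorem IsDepth.descIn_subset_insert (h : IsDepth G d) {A U F : Finset V} {v : V}
    (hF : IsFacetBetween G r A (U.erase v) F)
    (hv : ∀ u ∈ U, d v < d u → (descIn G d U u).card ≤ r) : descIn G d U v ⊆ insert v F := by
  obtain ⟨-, hFU, hFs, hmax⟩ := hF
  intro x hx
  rcases Relation.ReflTransGen.cases_head (mem_reachSet.1 hx) with rfl | ⟨u, ⟨huU, hvu, hlt⟩, hux⟩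
  · exact Finset.mem_insert_self _ _
  refine Finset.mem_insert_of_mem (hmax (F ∪ descIn G d U u) Finset.subset_union_left ?_ ?_
    (Finset.mem_union_right _ (mem_reachSet.2 hux)))
  · refine Finset.union_subset hFU fun y hy ↦ Finset.mem_erase.2 ⟨?_, descIn_subset huU hy⟩
    rintro rfl
    have := depth_le_of_mem_descIn hy
    omega
  · refine hFs.union subset_rfl ?_ (hv u huU hlt)
    intro a ha b hb hab
    rcases Finset.mem_union.1 hb with hb | hb
    · obtain ⟨hbv, hbU⟩ := Finset.mem_erase.1 (hFU hb)
      by_cases hau : a = u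
      · subst hau
        rcases lt_or_gt_of_ne (h.ne_of_adj hab) with hd | hd
        · exact descIn_step ha hbU hab hd
        · exact absurd (h.parent_unique hab.symm hvu hd hlt) hbv
      · exact h.mem_descIn_of_adj ha hau hbU hab
    · exact hb

/-- Either all of `U` has small components, or some vertex of `U \ A` is a shedding vertex. -/
theorem IsDepth.exists_shedding (h : IsDepth G d) {A U : Finset V} (hAU : A ⊆ U)
    (hA : SmallComponents G r A) (hU : ¬ SmallComponents G r U) :
    ∃ v ∈ U, v ∉ A ∧ ∀ F, IsFacetBetween G r A (U.erase v) F →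
      ¬ SmallComponents G r (insert v F) := by
  obtain ⟨v, hvU, hbig, hlow⟩ : ∃ v ∈ U, r < (descIn G d U v).card ∧
      ∀ u ∈ U, d v < d u → (descIn G d U u).card ≤ r := by
    have hne : (U.filter fun v ↦ r < (descIn G d U v).card).Nonempty := by
      by_contra hne
      refine hU (h.smallComponents fun v hv ↦ ?_)
      by_contra hlt
      exact hne ⟨v, Finset.mem_filter.2 ⟨hv, not_le.1 hlt⟩⟩
    obtain ⟨v, hv, hmax⟩ := Finset.exists_max_image _ d hne
    obtain ⟨hvU, hv⟩ := Finset.mem_filter.1 hv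
    refine ⟨v, hvU, hv, fun u hu hd ↦ ?_⟩
    by_contra hlt
    exact absurd (hmax u (Finset.mem_filter.2 ⟨hu, not_le.1 hlt⟩)) (not_le.2 hd)
  have hcontra : ∀ {S : Finset V}, SmallComponents G r S → ¬ descIn G d U v ⊆ S := fun {S} hS hsub ↦
    absurd (hbig.trans_le (Finset.card_le_card (descIn_subset_componentIn hsub)))
      (not_lt.2 (hS v (hsub (self_mem_reachSet _ _))))
  by_cases hvA : v ∉ A
  · exact ⟨v, hvU, hvA, fun F hF hs ↦ hcontra hs (h.descIn_subset_insert hF hlow)⟩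
  rw [not_not] at hvA
  classical
  set Q := descIn G d A v
  have hQA : Q ⊆ A := descIn_subset hvA
  let C := (U \ A).filter fun u ↦ ∃ z ∈ Q, G.Adj z u ∧ d z < d u
  have hC : ∀ {u}, u ∈ C ↔ (u ∈ U ∧ u ∉ A) ∧ ∃ z ∈ Q, G.Adj z u ∧ d z < d u := by simp [C]
  have hCd : ∀ u ∈ C, d v < d u := fun u hu ↦ by
    obtain ⟨-, z, hz, -, hd⟩ := hC.1 hu
    exact (depth_le_of_mem_descIn hz).trans_lt hd
  have hdisj : ∀ u ∈ C, ∀ q ∈ Q, q ∉ descIn G d U u := by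
    intro u hu q hq
    induction mem_reachSet.1 hq with
    | refl => exact fun hv ↦ absurd (hCd u hu) (not_lt.2 (depth_le_of_mem_descIn hv))
    | tail hab hbc ih =>
      intro hc
      refine ih (mem_reachSet.2 hab) (h.mem_descIn_of_adj hc ?_ (hAU (hQA (mem_reachSet.2 hab)))
        hbc.2.1.symm)
      rintro rfl
      exact (hC.1 hu).1.2 hbc.1
  have hcover : descIn G d U v ⊆ Q ∪ C.biUnion (descIn G d U) := by
    refine reachSet_subset (Finset.mem_union_left _ (self_mem_reachSet _ _)) ?_
    rintro a ha b ⟨hbU, hab, hd⟩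
    rcases Finset.mem_union.1 ha with ha | ha
    · by_cases hbA : b ∈ A
      · exact Finset.mem_union_left _ (descIn_step ha hbA hab hd)
      · exact Finset.mem_union_right _ (Finset.mem_biUnion.2
          ⟨b, hC.2 ⟨⟨hbU, hbA⟩, a, ha, hab, hd⟩, self_mem_reachSet _ _⟩)
    · obtain ⟨u, hu, hau⟩ := Finset.mem_biUnion.1 ha
      exact Finset.mem_union_right _ (Finset.mem_biUnion.2 ⟨u, hu, descIn_step hau hbU hab hd⟩)
  have hCne : C.Nonempty := by
    by_contra hne
    rw [Finset.not_nonempty_iff_eq_empty] at hne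
    rw [hne, Finset.biUnion_empty, Finset.union_empty] at hcover
    exact hcontra hA (hcover.trans hQA)
  obtain ⟨w, hw, hwmax⟩ := C.exists_max_image (fun u ↦ (descIn G d U u).card) hCne
  obtain ⟨⟨hwU, hwA⟩, z, hzQ, hzw, hzd⟩ := hC.1 hw
  refine ⟨w, hwU, hwA, fun F hF hs ↦ ?_⟩
  have hwsub : descIn G d U w ⊆ insert w F := h.descIn_subset_insert hF fun u hu hd ↦
    hlow u hu ((hCd w hw).trans hd)
  obtain ⟨hAF, hFU, hFs, hmax⟩ := hF
  have hQK : Q ⊆ componentIn G F v := descIn_subset_componentIn (hQA.trans hAF)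
  have hKF : componentIn G F v ⊆ F := componentIn_subset (hAF hvA)
  have hKw : Disjoint (componentIn G F v) (descIn G d U w) := by
    refine Finset.disjoint_left.2 ?_
    have : componentIn G F v ⊆ (descIn G d U w)ᶜ := by
      refine reachSet_subset (Finset.mem_compl.2 (hdisj w hw v (self_mem_reachSet _ _))) ?_
      rintro a ha b ⟨haF, hbF, hab⟩
      rw [Finset.mem_compl] at ha ⊢
      refine fun hb ↦ ha (h.mem_descIn_of_adj hb ?_ (Finset.mem_of_mem_erase (hFU haF)) hab.symm)
      rintro rfl
      exact absurd (hFU hbF) (Finset.notMem_erase _ _)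
    exact fun a ha ↦ Finset.mem_compl.1 (this ha)
  have hcard : (componentIn G F v).card + (descIn G d U w).card ≤ r := by
    rw [← Finset.card_union_of_disjoint hKw]
    refine (Finset.card_le_card (Finset.union_subset (componentIn_mono (Finset.subset_insert w F) v)
      ?_)).trans (hs v (Finset.mem_insert_of_mem (hAF hvA)))
    refine (descIn_subset_componentIn hwsub).trans (componentIn_subset_of_mem ?_)
    exact reachSet_step (componentIn_mono (Finset.subset_insert w F) v (hQK hzQ))
      ⟨Finset.mem_insert_of_mem (hAF (hQA hzQ)), Finset.mem_insert_self _ _, hzw⟩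
  refine hcontra hs (hcover.trans (Finset.union_subset
    ((hQA.trans hAF).trans (Finset.subset_insert _ _)) (Finset.biUnion_subset.2 fun u hu ↦ ?_)))
  by_cases huw : u = w
  · exact huw ▸ hwsub
  obtain ⟨⟨huU, huA⟩, y, hyQ, hyu, hyd⟩ := hC.1 hu
  refine (Finset.subset_union_right.trans (hmax (F ∪ descIn G d U u) Finset.subset_union_left ?_
    ?_)).trans (Finset.subset_insert _ _)
  · refine Finset.union_subset hFU fun x hx ↦ Finset.mem_erase.2 ⟨?_, descIn_subset huU hx⟩
    rintro rfl
    exact hdisj u hu z hzQ (h.mem_descIn_of_adj hx (Ne.symm huw) (hAU (hQA hzQ)) hzw.symm)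
  · refine hFs.union (M := componentIn G F v ∪ descIn G d U u) Finset.subset_union_right ?_ ?_
    · intro a ha b hb hab
      rcases Finset.mem_union.1 hb with hb | hb
      · have hbU := Finset.mem_of_mem_erase (hFU hb)
        rcases Finset.mem_union.1 ha with ha | ha
        · exact Finset.mem_union_left _ (reachSet_step ha ⟨hKF ha, hb, hab⟩)
        · by_cases hau : a = u
          · subst hau
            rcases lt_or_gt_of_ne (h.ne_of_adj hab) with hd | hd
            · exact Finset.mem_union_right _ (descIn_step ha hbU hab hd)
            · rw [h.parent_unique hab.symm hyu hd hyd]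
              exact Finset.mem_union_left _ (hQK hyQ)
          · exact Finset.mem_union_right _ (h.mem_descIn_of_adj ha hau hbU hab)
      · exact Finset.mem_union_right _ hb
    · have := hwmax u hu
      have := Finset.card_union_le (componentIn G F v) (descIn G d U u)
      omega

theorem exists_isFacetBetween {A U S : Finset V} (hAS : A ⊆ S) (hSU : S ⊆ U)
    (hS : SmallComponents G r S) : ∃ F, S ⊆ F ∧ IsFacetBetween G r A U F := by
  classical
  obtain ⟨F, hF, hmax⟩ := Finset.exists_max_image
    (U.powerset.filter fun F ↦ S ⊆ F ∧ SmallComponents G r F) Finset.card ⟨S, by simp [hSU, hS]⟩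
  simp only [Finset.mem_filter, Finset.mem_powerset] at hF hmax
  refine ⟨F, hF.2.1, hAS.trans hF.2.1, hF.1, hF.2.2, fun B hFB hBU hB ↦ ?_⟩
  exact (Finset.eq_of_subset_of_card_le hFB (hmax B ⟨hBU, hF.2.1.trans hFB, hB⟩)).ge

end Reach

section Shelling

variable {V : Type*} [DecidableEq V]

theorem IsRevShelling.append {L₂ L₁ : List (Finset V)} (h₂ : IsRevShelling L₂)
    (h₁ : IsRevShelling L₁)
    (h : ∀ F ∈ L₂, ∀ E ∈ L₁, ∃ H ∈ L₁, ∃ x ∈ F, x ∉ E ∧ F.erase x ⊆ H) :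
    IsRevShelling (L₂ ++ L₁) := by
  induction L₂ with
  | nil => exact h₁
  | cons F L ih =>
    refine ⟨ih h₂.1 fun F' hF' ↦ h F' (List.mem_cons_of_mem _ hF'), fun E hE ↦ ?_⟩
    rcases List.mem_append.1 hE with hE | hE
    · obtain ⟨H, hH, hx⟩ := h₂.2 E hE
      exact ⟨H, List.mem_append_left _ hH, hx⟩
    · obtain ⟨H, hH, hx⟩ := h F List.mem_cons_self E hE
      exact ⟨H, List.mem_append_right _ hH, hx⟩

theorem IsRevShelling.exists_getElem {L : List (Finset V)} (h : IsRevShelling L) {k i : ℕ}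
    (hki : k < i) (hi : i < L.length) :
    ∃ (j : ℕ) (hj : j < L.length), k < j ∧
      ∃ x ∈ L[k]'(hki.trans hi), x ∉ L[i] ∧ (L[k]'(hki.trans hi)).erase x ⊆ L[j] := by
  induction L generalizing k i with
  | nil => simp at hi
  | cons F L ih =>
    obtain ⟨i, rfl⟩ : ∃ m, i = m + 1 := ⟨i - 1, by omega⟩
    have hi' : i < L.length := by simpa using hi
    cases k with
    | zero =>
      obtain ⟨H, hH, hx⟩ := h.2 L[i] (List.getElem_mem hi')
      obtain ⟨j, hj, rfl⟩ := List.getElem_of_mem hH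
      exact ⟨j + 1, by simpa using hj, by omega, by simpa using hx⟩
    | succ k =>
      obtain ⟨j, hj, hkj, hx⟩ := ih h.1 (k := k) (by omega) hi'
      exact ⟨j + 1, by simpa using hj, by omega, by simpa using hx⟩

theorem IsDepth.exists_isRevShelling [Fintype V] {G : SimpleGraph V} {d : V → ℕ} {r : ℕ}
    (h : IsDepth G d) {A U : Finset V} (hAU : A ⊆ U) :
    ∃ L : List (Finset V), L.Nodup ∧ (∀ F, F ∈ L ↔ IsFacetBetween G r A U F) ∧
      IsRevShelling L := by
  induction hn : (U \ A).card using Nat.strong_induction_on generalizing A U with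
  | _ n ih =>
  by_cases hA : SmallComponents G r A
  swap
  · exact ⟨[], List.nodup_nil, fun F ↦ ⟨by simp, fun hF ↦ absurd (hF.2.2.1.mono hF.1) hA⟩, trivial⟩
  by_cases hU : SmallComponents G r U
  · refine ⟨[U], List.nodup_singleton _, fun F ↦ ?_, trivial, by simp⟩
    rw [List.mem_singleton]
    constructor
    · rintro rfl
      exact ⟨hAU, subset_rfl, hU, fun B _ hB _ ↦ hB⟩
    · exact fun hF ↦ hF.2.1.antisymm (hF.2.2.2 U hF.2.1 subset_rfl hU)
  obtain ⟨v, hvU, hvA, hshed⟩ := h.exists_shedding hAU hA hU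
  have hv : v ∈ U \ A := Finset.mem_sdiff.2 ⟨hvU, hvA⟩
  have hlt : ((U \ A).erase v).card < n := hn ▸ Finset.card_erase_lt_of_mem hv
  obtain ⟨L₁, hnd₁, hmem₁, hs₁⟩ := ih _ hlt (A := A) (U := U.erase v)
    (Finset.subset_erase.2 ⟨hAU, hvA⟩) (by congr 1; ext; simp; tauto)
  obtain ⟨L₂, hnd₂, hmem₂, hs₂⟩ := ih _ hlt (A := insert v A) (U := U)
    (Finset.insert_subset hvU hAU) (by congr 1; ext; simp; tauto)
  have hv₁ : ∀ F ∈ L₁, v ∉ F := fun F hF hvF ↦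
    Finset.notMem_erase v U (((hmem₁ F).1 hF).2.1 hvF)
  have hv₂ : ∀ F ∈ L₂, v ∈ F := fun F hF ↦ ((hmem₂ F).1 hF).1 (Finset.mem_insert_self _ _)
  refine ⟨L₂ ++ L₁, ?_, fun F ↦ ?_, hs₂.append hs₁ fun F hF E hE ↦ ?_⟩
  · exact List.nodup_append'.2 ⟨hnd₂, hnd₁, fun F h₂ h₁ ↦ hv₁ F h₁ (hv₂ F h₂)⟩
  · rw [List.mem_append, hmem₁, hmem₂]
    constructor
    · rintro (⟨hAF, hrest⟩ | hF)
      · exact ⟨(Finset.subset_insert _ _).trans hAF, hrest⟩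
      · obtain ⟨hAF, hFU, hFs, hmax⟩ := id hF
        refine ⟨hAF, hFU.trans (Finset.erase_subset _ _), hFs, fun B hFB hBU hB ↦ ?_⟩
        by_cases hvB : v ∈ B
        · exact absurd (hB.mono (Finset.insert_subset hvB hFB)) (hshed F hF)
        · exact hmax B hFB (Finset.subset_erase.2 ⟨hBU, hvB⟩) hB
    · rintro ⟨hAF, hFU, hFs, hmax⟩
      by_cases hvF : v ∈ F
      · exact .inl ⟨Finset.insert_subset hvF hAF, hFU, hFs, hmax⟩
      · exact .inr ⟨hAF, Finset.subset_erase.2 ⟨hFU, hvF⟩, hFs,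
          fun B hFB hBU ↦ hmax B hFB (hBU.trans (Finset.erase_subset _ _))⟩
  · obtain ⟨hAF, hFU, hFs, -⟩ := (hmem₂ F).1 hF
    obtain ⟨H, hFH, hH⟩ := exists_isFacetBetween (A := A) (U := U.erase v) (S := F.erase v)
      (Finset.subset_erase.2 ⟨(Finset.subset_insert _ _).trans hAF, hvA⟩)
      (Finset.erase_subset_erase v hFU) (hFs.mono (Finset.erase_subset _ _))
    exact ⟨H, (hmem₁ H).2 hH, v, hv₂ F hF, hv₁ E hE, hFH⟩

end Shelling

theorem SimpleGraph.IsTree.isDepth_dist {V : Type*} {T : SimpleGraph V} (hT : T.IsTree) (o : V) :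
    IsDepth T (T.dist o) where
  ne_of_adj hadj := hT.dist_ne_of_adj o hadj
  parent_unique {x y z} hy hz hdy hdz := by
    classical
    have key : ∀ {w} (hw : T.Adj w x), T.dist o w < T.dist o x →
        ∃ p : T.Walk o w, (p.concat hw).IsPath := by
      intro w hw hd
      obtain ⟨p, hp, hlen⟩ := hT.connected.exists_path_of_dist o w
      refine ⟨p, hp.concat (fun hx ↦ ?_) hw⟩
      have h₁ := SimpleGraph.dist_le (p.takeUntil x hx)
      have h₂ := p.length_takeUntil_le_length hx
      omega
    obtain ⟨p, hp⟩ := key hy hdy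
    obtain ⟨q, hq⟩ := key hz hdz
    have := congrArg SimpleGraph.Walk.penultimate ((hT.existsUnique_path o x).unique hp hq)
    simpa using this

theorem rIndep_iff_smallComponents {V : Type*} [Fintype V] {G : SimpleGraph V} {r : ℕ}
    {A : Finset V} : rIndep G r ↑A ↔ SmallComponents G r A := by
  have key : ∀ x : (A : Set V), (Subtype.val '' ((G.induce (A : Set V)).connectedComponentMk x).supp)
      = (componentIn G A x : Set V) := by
    intro x
    ext y
    simp only [Set.mem_image, SimpleGraph.ConnectedComponent.mem_supp_iff,
      SimpleGraph.ConnectedComponent.eq, Finset.mem_coe]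
    constructor
    · rintro ⟨y, hy, rfl⟩
      have hxy := (SimpleGraph.reachable_iff_reflTransGen _ _).1 hy.symm
      exact mem_reachSet.2 (hxy.lift Subtype.val fun a b hab ↦ ⟨a.2, b.2, hab⟩)
    · intro hy
      induction mem_reachSet.1 hy with
      | refl => exact ⟨x, .refl _, rfl⟩
      | tail hab hbc ih =>
        obtain ⟨b, hb, rfl⟩ := ih (mem_reachSet.2 hab)
        refine ⟨⟨_, hbc.2.1⟩, SimpleGraph.Reachable.trans (SimpleGraph.Adj.reachable ?_) hb, rfl⟩
        exact hbc.2.2.symm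
  have hcard : ∀ x : (A : Set V), ((G.induce (A : Set V)).connectedComponentMk x).supp.ncard
      = (componentIn G A x).card := fun x ↦ by
    rw [← Set.ncard_coe_finset, ← key x, Set.ncard_image_of_injective _ Subtype.val_injective]
  constructor
  · exact fun h x hx ↦ hcard ⟨x, hx⟩ ▸ h _
  · intro h c
    induction c using SimpleGraph.ConnectedComponent.ind with
    | _ x => exact hcard x ▸ h x x.2

/-- For a finite tree `T` and `r ≥ 1`, the complex `Ind_r(T)` is shellable: there is a
linear order `F 0, F 1, …` of its facets such that for every `k ≥ 1`, every maximal
element of `{F' ⊆ F k : F' ⊆ F j for some j < k}` has cardinality `|F k| - 1`. -/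
theorem indComplex_shellable_of_isTree {V : Type*} [Fintype V] [DecidableEq V]
    (T : SimpleGraph V) (hT : T.IsTree) (r : ℕ) (hr : 1 ≤ r) :
    ∃ (t : ℕ) (F : Fin t → Finset V),
      Function.Injective F ∧
      (∀ A : Finset V, IsIndFacet T r A ↔ ∃ k : Fin t, F k = A) ∧
      (∀ k : Fin t, 0 < (k : ℕ) →
        ∀ F' : Finset V, F' ⊆ F k → (∃ j : Fin t, j < k ∧ F' ⊆ F j) →
          (∀ F'' : Finset V, F'' ⊆ F k → (∃ j : Fin t, j < k ∧ F'' ⊆ F j) →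
            F' ⊆ F'' → F' = F'') →
          F'.card = (F k).card - 1) := by
  obtain ⟨o⟩ := hT.connected.nonempty
  obtain ⟨L, hnd, hmem, hL⟩ := (hT.isDepth_dist o).exists_isRevShelling (r := r)
    (Finset.empty_subset Finset.univ)
  have hfacet : ∀ A : Finset V, IsIndFacet T r A ↔ A ∈ L := by
    intro A
    simp only [hmem, IsFacetBetween, IsIndFacet, rIndep_iff_smallComponents, Finset.empty_subset,
      Finset.subset_univ, true_and, forall_const]
    exact and_congr_right fun _ ↦ ⟨fun h B hAB hB ↦ (h B hB hAB).ge,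
      fun h B hB hAB ↦ hAB.antisymm (h B hAB hB)⟩
  refine ⟨L.length, fun k ↦ L.get k.rev, ?_, fun A ↦ ?_, ?_⟩
  · exact (List.nodup_iff_injective_get.1 hnd).comp Fin.rev_injective
  · rw [hfacet, List.mem_iff_get]
    exact ⟨fun ⟨k, hk⟩ ↦ ⟨k.rev, by simpa using hk⟩, fun ⟨k, hk⟩ ↦ ⟨k.rev, hk⟩⟩
  · rintro k - F' hF' ⟨i, hik, hF'i⟩ hmax
    obtain ⟨j, hj, hkj, x, hx, hxi, hsub⟩ :=
      hL.exists_getElem (Fin.rev_lt_rev.2 hik) i.rev.isLt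
    have hjk : Fin.rev ⟨j, hj⟩ < k := by
      rw [← Fin.rev_lt_rev, Fin.rev_rev]
      exact hkj
    have heq := hmax ((L.get k.rev).erase x) (Finset.erase_subset _ _)
      ⟨Fin.rev ⟨j, hj⟩, hjk, by simpa using hsub⟩
      (Finset.subset_erase.2 ⟨hF', fun hxF' ↦ hxi (hF'i hxF')⟩)
    rw [heq]
    exact Finset.card_erase_of_mem hx
end

section
/- Let CG be a finite caterpillar graph and r ≥ 1. Then the r-independence complex Ind_r(CG) is vertex decomposable. -/
/-- The `r`-independence complex `Ind_r(G)`, as the (finite) family of its faces,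
i.e. of all `r`-independent subsets of `V(G)`. -/
noncomputable def indComplex {V : Type*} [Fintype V] [DecidableEq V]
    (G : SimpleGraph V) (r : ℕ) : Finset (Finset V) :=
  @Finset.filter _ (fun A : Finset V => rIndep G r ↑A) (Classical.decPred _) Finset.univ

/-- The link of a vertex `x` in a simplicial complex `K`. -/
def linkCpx {α : Type*} [DecidableEq α] (K : Finset (Finset α)) (x : α) :
    Finset (Finset α) :=
  K.filter fun F => x ∉ F ∧ insert x F ∈ K

/-- The deletion of a vertex `x` in a simplicial complex `K`. -/
def delCpx {α : Type*} [DecidableEq α] (K : Finset (Finset α)) (x : α) :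
    Finset (Finset α) :=
  K.filter fun F => x ∉ F

/-- `F` is a facet (maximal face) of the complex `K`. -/
def IsFacetOf {α : Type*} (K : Finset (Finset α)) (F : Finset α) : Prop :=
  F ∈ K ∧ ∀ F' ∈ K, F ⊆ F' → F = F'

/-- A finite simplicial complex (given by the finite family of its faces) is vertex
decomposable if it is a simplex, or some vertex `x` has vertex decomposable link and
deletion, with every facet of the deletion being a facet of the whole complex. -/
inductive IsVertexDecomposable {α : Type*} [DecidableEq α] : Finset (Finset α) → Prop
  | simplex (s : Finset α) : IsVertexDecomposable s.powerset
  | step (K : Finset (Finset α)) (x : α) (hx : ∃ F ∈ K, x ∈ F) :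
      IsVertexDecomposable (linkCpx K x) →
      IsVertexDecomposable (delCpx K x) →
      (∀ F : Finset α, IsFacetOf (delCpx K x) F → IsFacetOf K F) →
      IsVertexDecomposable K

/-- A caterpillar graph: a tree with a central path such that every vertex lies on the
path or is adjacent to a vertex of the path. -/
def IsCaterpillar {V : Type*} (G : SimpleGraph V) : Prop :=
  G.IsTree ∧ ∃ (u w : V) (P : G.Walk u w), P.IsPath ∧
    ∀ v : V, v ∈ P.support ∨ ∃ x ∈ P.support, G.Adj v x

namespace SimpleGraph

variable {V : Type*} {G : SimpleGraph V}

lemma forall_mem_of_induce_connected {B : Set V} (hB : (G.induce B).Connected) {P : V → Prop}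
    {z : V} (hz : z ∈ B) (hPz : P z)
    (hstep : ∀ u ∈ B, ∀ v ∈ B, G.Adj u v → P u → P v) : ∀ u ∈ B, P u := by
  intro u hu
  obtain ⟨w⟩ := hB.preconnected ⟨z, hz⟩ ⟨u, hu⟩
  have key : ∀ (a b : B) (_ : (G.induce B).Walk a b), P a → P b := by
    intro a b w
    induction w with
    | nil => exact id
    | cons h _ ih => exact fun ha => ih (hstep _ (Subtype.prop _) _ (Subtype.prop _) h ha)
  exact key _ _ w hPz

lemma induce_image_connected {B : Set V} (hB : (G.induce B).Connected) (f : V → V)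
    (hf : ∀ u ∈ B, ∀ v ∈ B, G.Adj u v → f u = f v ∨ G.Adj (f u) (f v)) :
    (G.induce (f '' B)).Connected := by
  obtain ⟨z, hz⟩ := hB.nonempty
  rw [connected_iff_exists_forall_reachable]
  refine ⟨⟨f z, z, hz, rfl⟩, ?_⟩
  have key := forall_mem_of_induce_connected hB (z := z) hz
    (P := fun u => ∃ h : f u ∈ f '' B, (G.induce (f '' B)).Reachable ⟨f z, z, hz, rfl⟩ ⟨f u, h⟩)
    ⟨⟨z, hz, rfl⟩, .rfl⟩ (by
      rintro u hu v hv huv ⟨h, hr⟩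
      refine ⟨⟨v, hv, rfl⟩, ?_⟩
      rcases hf u hu v hv huv with he | ha
      · simpa only [← he] using hr
      · exact hr.trans (Adj.reachable (G := G.induce (f '' B)) (v := ⟨f v, v, hv, rfl⟩) ha))
  rintro ⟨_, u, hu, rfl⟩
  exact (key u hu).2

lemma exists_adj_mem_of_induce_connected {B : Finset V} (hB : (G.induce (B : Set V)).Connected)
    {z : V} (hz : z ∈ B) (hcard : 1 < B.card) : ∃ v ∈ B, G.Adj z v := by
  by_contra! h
  obtain ⟨u, hu, hne⟩ := Finset.exists_mem_ne hcard z
  refine hne (forall_mem_of_induce_connected hB (P := (· = z)) hz rfl ?_ u hu)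
  rintro _ _ v hv huv rfl
  exact absurd huv (h v hv)

/-- In an acyclic graph, a path joining two adjacent vertices is a single edge. -/
lemma IsAcyclic.length_eq_one_of_adj (hG : G.IsAcyclic) {u v : V} (huv : G.Adj u v)
    (q : G.Walk u v) (hq : q.IsPath) : q.length = 1 := by
  have h : q = (Path.singleton huv : G.Walk u v) :=
    congrArg Subtype.val ((hG.subsingleton_path u v).elim ⟨q, hq⟩ (Path.singleton huv))
  rw [h]
  rfl

lemma Walk.IsPath.exists_subpath {u w : V} {P : G.Walk u w} (hP : P.IsPath) {a b : ℕ}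
    (hab : a ≤ b) (hb : b ≤ P.length) :
    ∃ q : G.Walk (P.getVert a) (P.getVert b),
      q.IsPath ∧ q.length = b - a ∧ q.support ⊆ P.support := by
  have he : (P.drop a).getVert (b - a) = P.getVert b := by
    rw [Walk.drop_getVert, Nat.add_sub_cancel' hab]
  refine ⟨((P.drop a).take (b - a)).copy rfl he, ?_, ?_, ?_⟩
  · rw [Walk.isPath_copy]
    exact (hP.drop a).take _
  · rw [Walk.length_copy, Walk.take_length, Walk.drop_length]
    omega
  · rw [Walk.support_copy, Walk.support_take, Walk.drop_support_eq_support_drop_min]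
    exact fun _ h => List.drop_subset _ _ (List.take_subset _ _ h)

end SimpleGraph

/-- `A` contains no connected set of more than `r` vertices. -/
def NoLargeConnected {V : Type*} (G : SimpleGraph V) (r : ℕ) (A : Finset V) : Prop :=
  ∀ B : Finset V, B ⊆ A → (G.induce (B : Set V)).Connected → B.card ≤ r

lemma NoLargeConnected.mono {V : Type*} {G : SimpleGraph V} {r : ℕ} {A A' : Finset V}
    (h : NoLargeConnected G r A') (hA : A ⊆ A') : NoLargeConnected G r A :=
  fun B hB => h B (hB.trans hA)

lemma rIndep_coe_iff {V : Type*} (G : SimpleGraph V) (r : ℕ) (A : Finset V) :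
    rIndep G r (A : Set V) ↔ NoLargeConnected G r A := by
  classical
  constructor
  · intro h B hBA hB
    obtain ⟨z, hz⟩ := hB.nonempty
    let c := (G.induce (A : Set V)).connectedComponentMk ⟨z, hBA hz⟩
    refine le_trans ?_ (h c)
    rw [← Set.ncard_image_of_injective _ Subtype.val_injective, ← Set.ncard_coe_finset B]
    refine Set.ncard_le_ncard ?_ ((Set.toFinite _).image _)
    intro u hu
    refine ⟨⟨u, hBA hu⟩, ?_, rfl⟩
    have hr := (hB.preconnected ⟨u, hu⟩ ⟨z, hz⟩).map
      (SimpleGraph.induceHomOfLE G (s := (B : Set V)) (s' := (A : Set V)) hBA).toHom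
    exact SimpleGraph.ConnectedComponent.sound hr
  · intro h c
    have hfin : (Subtype.val '' c.supp : Set V).Finite := (Set.toFinite _).image _
    have hle := h hfin.toFinset (by
      intro u hu
      obtain ⟨a, -, rfl⟩ := hfin.mem_toFinset.1 hu
      exact a.2) (by
      rw [hfin.coe_toFinset]
      have hc : ((G.induce (A : Set V)).induce c.supp).Connected := c.connected_toSimpleGraph
      let f : (G.induce (A : Set V)).induce c.supp →g
          G.induce (Subtype.val '' c.supp : Set V) :=
        ⟨fun a => ⟨a.1.1, a.1, a.2, rfl⟩, fun h => h⟩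
      refine hc.map f ?_
      rintro ⟨_, a, ha, rfl⟩
      exact ⟨⟨a, ha⟩, rfl⟩)
    rwa [← Set.ncard_eq_toFinset_card _ hfin,
      Set.ncard_image_of_injective _ Subtype.val_injective] at hle

/-- `p` enumerates the spine of a caterpillar, and `pos` sends each vertex to the index of the
spine vertex that it equals or hangs from. -/
structure CaterpillarLayout {V : Type*} (G : SimpleGraph V) (p : ℕ → V) (pos : V → ℕ) : Prop where
  step : ∀ k, p k = p (k + 1) ∨ G.Adj (p k) (p (k + 1))
  adj : ∀ u v, G.Adj u v →
    (p (pos u) = u ∧ p (pos v) = v ∧ (pos u = pos v + 1 ∨ pos v = pos u + 1)) ∨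
    (pos u = pos v ∧ (p (pos u) = u ∨ p (pos v) = v))

lemma IsCaterpillar.exists_layout {V : Type*} {G : SimpleGraph V} (hG : IsCaterpillar G) :
    ∃ (p : ℕ → V) (pos : V → ℕ), CaterpillarLayout G p pos := by
  obtain ⟨hT, s, t, P, hP, hcov⟩ := hG
  have hpos : ∀ v, ∃ k ≤ P.length,
      P.getVert k = v ∨ (v ∉ P.support ∧ G.Adj v (P.getVert k)) := by
    intro v
    by_cases hv : v ∈ P.support
    · obtain ⟨k, hk, hkl⟩ := SimpleGraph.Walk.mem_support_iff_exists_getVert.1 hv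
      exact ⟨k, hkl, .inl hk⟩
    · obtain ⟨x, hx, hadj⟩ := (hcov v).resolve_left hv
      obtain ⟨k, rfl, hkl⟩ := SimpleGraph.Walk.mem_support_iff_exists_getVert.1 hx
      exact ⟨k, hkl, .inr ⟨hv, hadj⟩⟩
  choose pos hle hpos using hpos
  have hmem : ∀ k, P.getVert k ∈ P.support := fun k => P.getVert_mem_support k
  have main : ∀ u v, G.Adj u v → pos u ≤ pos v →
      (P.getVert (pos u) = u ∧ P.getVert (pos v) = v ∧ pos v = pos u + 1) ∨
      (pos u = pos v ∧ (P.getVert (pos u) = u ∨ P.getVert (pos v) = v)) := by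
    intro u v huv huv'
    obtain ⟨q, hq, hql, hqs⟩ := hP.exists_subpath huv' (hle v)
    rcases hpos u with hu | ⟨hu, hua⟩ <;> rcases hpos v with hv | ⟨hv, hva⟩
    · have h1 := hT.isAcyclic.length_eq_one_of_adj huv (q.copy hu hv) (by simpa using hq)
      rw [SimpleGraph.Walk.length_copy] at h1
      exact .inl ⟨hu, hv, by omega⟩
    · have h1 := hT.isAcyclic.length_eq_one_of_adj huv ((q.concat hva.symm).copy hu rfl)
        (by simpa using hq.concat (fun h => hv (hqs h)) hva.symm)
      rw [SimpleGraph.Walk.length_copy, SimpleGraph.Walk.length_concat] at h1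
      exact .inr ⟨by omega, .inl hu⟩
    · have h1 := hT.isAcyclic.length_eq_one_of_adj huv ((q.cons hua).copy rfl hv)
        (by simpa using hq.cons (h := hua) (fun h => hu (hqs h)))
      rw [SimpleGraph.Walk.length_copy, SimpleGraph.Walk.length_cons] at h1
      exact .inr ⟨by omega, .inr hv⟩
    · have h1 := hT.isAcyclic.length_eq_one_of_adj huv ((q.cons hua).concat hva.symm)
        ((hq.cons (h := hua) (fun h => hu (hqs h))).concat (by
          rw [SimpleGraph.Walk.support_cons, List.mem_cons, not_or]
          exact ⟨huv.ne', fun h => hv (hqs h)⟩) hva.symm)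
      rw [SimpleGraph.Walk.length_concat, SimpleGraph.Walk.length_cons] at h1
      omega
  refine ⟨P.getVert, pos, ⟨fun k => ?_, fun u v huv => ?_⟩⟩
  · rcases lt_or_ge k P.length with hk | hk
    · exact .inr (P.adj_getVert_succ hk)
    · exact .inl (by rw [P.getVert_of_length_le hk, P.getVert_of_length_le (hk.trans k.le_succ)])
  · rcases le_total (pos u) (pos v) with h | h
    · have := main u v huv h
      tauto
    · have := main v u huv.symm h
      have e : pos u = pos v ↔ pos v = pos u := eq_comm
      tauto

namespace CaterpillarLayout

variable {V : Type*} {G : SimpleGraph V} {p : ℕ → V} {pos : V → ℕ}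

lemma exists_spine_mem (hL : CaterpillarLayout G p pos) {B : Finset V}
    (hB : (G.induce (B : Set V)).Connected) (hcard : 1 < B.card) {u : V} (hu : u ∈ B) :
    p (pos u) ∈ B ∧ pos (p (pos u)) = pos u := by
  by_cases hs : p (pos u) = u
  · rw [hs]
    exact ⟨hu, rfl⟩
  · obtain ⟨v, hv, huv⟩ := SimpleGraph.exists_adj_mem_of_induce_connected hB hu hcard
    rcases hL.adj u v huv with ⟨h, -⟩ | ⟨he, h | h⟩
    · exact absurd h hs
    · exact absurd h hs
    · rw [he, h]
      exact ⟨hv, rfl⟩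

lemma retract_adj (hL : CaterpillarLayout G p pos) (m : ℕ) {u v : V} (huv : G.Adj u v) :
    p (max (pos u) m) = p (max (pos v) m) ∨ G.Adj (p (max (pos u) m)) (p (max (pos v) m)) := by
  have h : max (pos u) m = max (pos v) m ∨ max (pos u) m = max (pos v) m + 1 ∨
      max (pos v) m = max (pos u) m + 1 := by
    rcases hL.adj u v huv with ⟨-, -, h⟩ | ⟨h, -⟩ <;> omega
  rcases h with h | h | h
  · exact .inl (by rw [h])
  · rw [h]
    exact (hL.step _).imp Eq.symm SimpleGraph.Adj.symm
  · rw [h]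
    exact hL.step _

/-- A leaf `z` may be exchanged for a vertex `x` provided `x` and the neighbour of `z` lie in a
connected set whose other vertices all belong to `A`. -/
lemma noLargeConnected_insert_leaf [DecidableEq V] (hL : CaterpillarLayout G p pos) {r : ℕ}
    (hr : 1 ≤ r) {A W : Finset V} {x z : V} (hx : x ∉ A) (hxz : z ≠ x)
    (hA : NoLargeConnected G r (insert x A)) (hz : p (pos z) ≠ z)
    (hW : (G.induce (W : Set V)).Connected) (hWA : W ⊆ insert x A) (hxW : x ∈ W)
    (hzW : p (pos z) ∈ W) : NoLargeConnected G r (insert z A) := by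
  intro B hBA hB
  by_contra! hcard
  have hcard1 : 1 < B.card := by omega
  by_cases hzB : z ∈ B
  swap
  · refine hcard.not_ge (hA B ?_ hB)
    intro u hu
    rcases Finset.mem_insert.1 (hBA hu) with rfl | h
    · exact absurd hu hzB
    · exact Finset.mem_insert_of_mem h
  have hsB := (hL.exists_spine_mem hB hcard1 hzB).1
  have hzadj : ∀ v, G.Adj z v → v = p (pos z) := by
    intro v hv
    rcases hL.adj z v hv with ⟨h, -⟩ | ⟨he, h | h⟩
    · exact absurd h hz
    · exact absurd h hz
    · rw [he, h]
  have himg : (B.erase z : Set V) = (fun u => if u = z then p (pos z) else u) '' (B : Set V) := by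
    ext u
    simp only [Finset.coe_erase, Set.mem_sdiff, Finset.mem_coe, Set.mem_singleton_iff,
      Set.mem_image]
    constructor
    · rintro ⟨hu, hne⟩
      exact ⟨u, hu, if_neg hne⟩
    · rintro ⟨a, ha, rfl⟩
      split_ifs with h
      · exact ⟨hsB, hz⟩
      · exact ⟨ha, h⟩
  have herase : (G.induce (B.erase z : Set V)).Connected := by
    rw [himg]
    refine SimpleGraph.induce_image_connected hB _ ?_
    intro u _ v _ huv
    by_cases hu : u = z
    · subst hu
      rw [if_pos rfl, if_neg huv.ne']
      exact .inl (hzadj v huv).symm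
    · by_cases hv : v = z
      · subst hv
        rw [if_pos rfl, if_neg hu]
        exact .inl (hzadj u huv.symm)
      · rw [if_neg hu, if_neg hv]
        exact .inr huv
  have hunion := SimpleGraph.induce_union_connected herase.preconnected hW.preconnected
    ⟨p (pos z), Finset.mem_coe.2 (Finset.mem_erase.2 ⟨hz, hsB⟩), hzW⟩
  rw [← Finset.coe_union] at hunion
  have hsub : B.erase z ⊆ A := by
    intro u hu
    obtain ⟨hne, hu⟩ := Finset.mem_erase.1 hu
    exact (Finset.mem_insert.1 (hBA hu)).resolve_left hne
  have hle := hA (B.erase z ∪ W)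
    (Finset.union_subset (hsub.trans (Finset.subset_insert _ _)) hWA) hunion
  have hins : insert x (B.erase z) ⊆ B.erase z ∪ W :=
    Finset.insert_subset (Finset.mem_union_right _ hxW) Finset.subset_union_left
  have h1 := Finset.card_le_card hins
  rw [Finset.card_insert_of_notMem (fun h => hx (hsub h)), Finset.card_erase_of_mem hzB] at h1
  omega

/-- Removing the spine vertex `x` cuts off the vertices at positions up to `pos x`. -/
lemma noLargeConnected_insert_of_pos_le [DecidableEq V] (hL : CaterpillarLayout G p pos) {r : ℕ}
    (hr : 1 ≤ r) {A : Finset V} {x z : V} (hx : x ∉ A) (hxz : z ≠ x) (hA : NoLargeConnected G r A)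
    (hxs : p (pos x) = x) (hzx : pos z ≤ pos x)
    (hlow : NoLargeConnected G r ((insert z A).filter (pos · < pos x))) :
    NoLargeConnected G r (insert z A) := by
  intro B hBA hB
  by_contra! hcard
  have hcard1 : 1 < B.card := by omega
  have hxB : x ∉ B := by
    intro h
    rcases Finset.mem_insert.1 (hBA h) with h | h
    · exact hxz h.symm
    · exact hx h
  by_cases hzB : z ∈ B
  swap
  · refine hcard.not_ge (hA B ?_ hB)
    intro u hu
    rcases Finset.mem_insert.1 (hBA hu) with rfl | h
    · exact absurd hu hzB
    · exact h
  have hne : ∀ u ∈ B, pos u ≠ pos x := by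
    intro u hu he
    have := (hL.exists_spine_mem hB hcard1 hu).1
    rw [he, hxs] at this
    exact hxB this
  have hlt : ∀ u ∈ B, pos u < pos x := by
    refine SimpleGraph.forall_mem_of_induce_connected hB (z := z) hzB
      (lt_of_le_of_ne hzx (hne z hzB)) ?_
    intro u _ v hv huv hu
    have := hne v hv
    rcases hL.adj u v huv with ⟨-, -, h⟩ | ⟨h, -⟩ <;> omega
  exact hcard.not_ge (hlow B (fun u hu => Finset.mem_filter.2 ⟨hBA hu, hlt u hu⟩) hB)

/-- Some `x ∈ S` is a shedding vertex for the complex of all `F ⊆ S` such that `F ∪ C` is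
`r`-independent. -/
lemma exists_shedding [DecidableEq V] (hL : CaterpillarLayout G p pos) {r : ℕ}
    (hr : 1 ≤ r) {C S : Finset V} (hCS : Disjoint C S) (hC : NoLargeConnected G r C)
    (hU : ¬ NoLargeConnected G r (S ∪ C)) :
    ∃ x ∈ S, ∀ F ⊆ S, x ∉ F → NoLargeConnected G r (insert x (F ∪ C)) →
      ∃ z ∈ S, z ≠ x ∧ z ∉ F ∧ NoLargeConnected G r (insert z (F ∪ C)) := by
  have hex : ∃ i, ¬ NoLargeConnected G r ((S ∪ C).filter (pos · ≤ i)) := by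
    refine ⟨(S ∪ C).sup pos, ?_⟩
    rwa [Finset.filter_true_of_mem fun u hu => Finset.le_sup (f := pos) hu]
  classical
  have hi := Nat.find_spec hex
  have hmin : ∀ m ≤ Nat.find hex, NoLargeConnected G r ((S ∪ C).filter (pos · < m)) := by
    intro m hm
    rcases m with _ | m
    · intro B hB hconn
      obtain ⟨u, hu⟩ := hconn.nonempty
      simpa using hB hu
    · have := not_not.1 (Nat.find_min hex (Nat.lt_of_succ_le hm))
      simpa only [Nat.lt_succ_iff] using this
  generalize Nat.find hex = i at hi hmin
  unfold NoLargeConnected at hi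
  push Not at hi
  obtain ⟨D, hDU, hD, hDr⟩ := hi
  have hD1 : 1 < D.card := by omega
  have hmiss : ∀ x F, NoLargeConnected G r (insert x (F ∪ C)) →
      ∃ z ∈ D, z ∈ S ∧ z ≠ x ∧ z ∉ F ∧ z ∉ C := by
    intro x F h
    by_contra! hcon
    refine hDr.not_ge (h D ?_ hD)
    intro u hu
    have hu' := (Finset.mem_filter.1 (hDU hu)).1
    have := hcon u hu
    simp only [Finset.mem_insert, Finset.mem_union] at hu' ⊢
    tauto
  have hSC : ∀ {x}, x ∈ S → x ∉ C := fun h hc => Finset.disjoint_left.1 hCS hc h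
  rcases (D.filter fun u => u ∈ S ∧ p (pos u) = u).eq_empty_or_nonempty with hT | hT
  · have hspine : ∀ u ∈ D, p (pos u) ∈ C := by
      intro u hu
      obtain ⟨hm, he⟩ := hL.exists_spine_mem hD hD1 hu
      have h1 : p (pos u) ∉ S := by
        intro hS
        have : p (pos u) ∈ D.filter fun u => u ∈ S ∧ p (pos u) = u :=
          Finset.mem_filter.2 ⟨hm, hS, by rw [he]⟩
        rw [hT] at this
        simp at this
      exact (Finset.mem_union.1 (Finset.mem_filter.1 (hDU hm)).1).resolve_left h1
    have hDC : ∃ x ∈ D, x ∈ S := by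
      by_contra! h
      exact hDr.not_ge (hC D (fun u hu =>
        (Finset.mem_union.1 (Finset.mem_filter.1 (hDU hu)).1).resolve_left (h u hu)) hD)
    obtain ⟨x, hxD, hxS⟩ := hDC
    have hns : ∀ z ∈ D, z ∈ S → p (pos z) ≠ z := fun z hz hzS h =>
      hSC hzS (h ▸ hspine z hz)
    refine ⟨x, hxS, fun F _ hxF hF => ?_⟩
    obtain ⟨z, hzD, hzS, hzx, hzF, -⟩ := hmiss x F hF
    refine ⟨z, hzS, hzx, hzF, ?_⟩
    let f : V → V := fun u => if u = x then x else p (pos u)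
    refine hL.noLargeConnected_insert_leaf hr (W := D.image f)
      (by simp [hxF, hSC hxS]) hzx hF (hns z hzD hzS) ?_ ?_ ?_ ?_
    · rw [Finset.coe_image]
      have hxadj : ∀ v, G.Adj x v → G.Adj x (p (pos v)) := by
        intro v hv
        have hx := hns x hxD hxS
        rcases hL.adj x v hv with ⟨h, -⟩ | ⟨he, h | h⟩
        · exact absurd h hx
        · exact absurd h hx
        · rwa [h]
      refine SimpleGraph.induce_image_connected hD f ?_
      intro u _ v _ huv
      by_cases hu : u = x
      · subst hu
        simp only [f, if_pos, if_neg huv.ne']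
        exact .inr (hxadj v huv)
      · by_cases hv : v = x
        · subst hv
          simp only [f, if_pos, if_neg hu]
          exact .inr (hxadj u huv.symm).symm
        · simpa only [f, if_neg hu, if_neg hv, Nat.max_zero] using hL.retract_adj 0 huv
    · intro u hu
      obtain ⟨a, ha, rfl⟩ := Finset.mem_image.1 hu
      by_cases hax : a = x
      · simp [f, hax]
      · simp [f, hax, hspine a ha]
    · exact Finset.mem_image.2 ⟨x, hxD, if_pos rfl⟩
    · exact Finset.mem_image.2 ⟨z, hzD, if_neg hzx⟩
  · obtain ⟨x, hxT, hmax⟩ := Finset.exists_max_image _ pos hT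
    obtain ⟨hxD, hxS, hxs⟩ := Finset.mem_filter.1 hxT
    refine ⟨x, hxS, fun F hFS hxF hF => ?_⟩
    obtain ⟨z, hzD, hzS, hzx, hzF, -⟩ := hmiss x F hF
    refine ⟨z, hzS, hzx, hzF, ?_⟩
    have hxA : x ∉ F ∪ C := by simp [hxF, hSC hxS]
    rcases le_or_gt (pos z) (pos x) with hpos | hpos
    · refine hL.noLargeConnected_insert_of_pos_le hr hxA hzx
        (hF.mono (Finset.subset_insert _ _)) hxs hpos
        ((hmin (pos x) (Finset.mem_filter.1 (hDU hxD)).2).mono ?_)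
      exact Finset.filter_subset_filter _ (Finset.insert_subset (Finset.mem_union_left _ hzS)
        (Finset.union_subset_union_left hFS))
    · have hzs : p (pos z) ≠ z := fun h =>
        hpos.not_ge (hmax z (Finset.mem_filter.2 ⟨hzD, hzS, h⟩))
      refine hL.noLargeConnected_insert_leaf hr
        (W := D.image fun u => p (max (pos u) (pos x))) hxA hzx hF hzs ?_ ?_ ?_ ?_
      · rw [Finset.coe_image]
        exact SimpleGraph.induce_image_connected hD _
          fun u _ v _ huv => hL.retract_adj (pos x) huv
      · intro u hu
        obtain ⟨a, ha, rfl⟩ := Finset.mem_image.1 hu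
        rcases le_or_gt (pos a) (pos x) with h | h
        · simp [max_eq_right h, hxs]
        · obtain ⟨hm, he⟩ := hL.exists_spine_mem hD hD1 ha
          simp only [max_eq_left h.le]
          have hnS : p (pos a) ∉ S := by
            intro hS
            have := hmax _ (Finset.mem_filter.2 ⟨hm, hS, by rw [he]⟩)
            omega
          have := (Finset.mem_union.1 (Finset.mem_filter.1 (hDU hm)).1).resolve_left hnS
          simp [this]
      · exact Finset.mem_image.2 ⟨x, hxD, by simp [hxs]⟩
      · exact Finset.mem_image.2 ⟨z, hzD, by simp [max_eq_left hpos.le]⟩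

open Classical in
lemma isVertexDecomposable [DecidableEq V] (hL : CaterpillarLayout G p pos) {r : ℕ}
    (hr : 1 ≤ r) (n : ℕ) : ∀ C S : Finset V, S.card = n → Disjoint C S →
      NoLargeConnected G r C →
      IsVertexDecomposable (S.powerset.filter fun F => NoLargeConnected G r (F ∪ C)) := by
  induction n with
  | zero =>
    intro C S hS _ hC
    rw [Finset.card_eq_zero] at hS
    subst hS
    rw [Finset.filter_true_of_mem]
    · exact .simplex _
    · intro F hF
      rw [Finset.powerset_empty, Finset.mem_singleton] at hF
      rwa [hF, Finset.empty_union]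
  | succ n ih =>
    intro C S hS hCS hC
    by_cases hU : NoLargeConnected G r (S ∪ C)
    · rw [Finset.filter_true_of_mem]
      · exact .simplex _
      · exact fun F hF =>
          hU.mono (Finset.union_subset_union_left (Finset.mem_powerset.1 hF))
    obtain ⟨x, hxS, hshed⟩ := hL.exists_shedding hr hCS hC hU
    have hxC : x ∉ C := fun h => Finset.disjoint_left.1 hCS h hxS
    have hcard : (S.erase x).card = n := by
      rw [Finset.card_erase_of_mem hxS, hS, Nat.add_sub_cancel]
    have hdel := ih C (S.erase x) hcard (hCS.mono_right (Finset.erase_subset _ _)) hC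
    by_cases hxF : NoLargeConnected G r (insert x C)
    · refine .step _ x ⟨{x}, ?_, Finset.mem_singleton_self x⟩ ?_ ?_ ?_
      · simpa [hxS] using hxF
      · convert ih (insert x C) (S.erase x) hcard ?_ hxF using 1
        · ext F
          simp only [linkCpx, Finset.mem_filter, Finset.mem_powerset, Finset.insert_union,
            Finset.union_insert, Finset.subset_erase, Finset.insert_subset_iff]
          refine ⟨fun h => ⟨⟨h.1.1, h.2.1⟩, h.2.2.2⟩,
            fun h => ⟨⟨h.1.1, ?_⟩, h.1.2, ⟨hxS, h.1.1⟩, h.2⟩⟩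
          exact h.2.mono (Finset.subset_insert _ _)
        · rw [Finset.disjoint_insert_left]
          exact ⟨Finset.notMem_erase _ _, hCS.mono_right (Finset.erase_subset _ _)⟩
      · convert hdel using 1
        ext F
        simp only [delCpx, Finset.mem_filter, Finset.mem_powerset, Finset.subset_erase]
        tauto
      · rintro F ⟨hF, hFmax⟩
        obtain ⟨hFK, hxF'⟩ := Finset.mem_filter.1 hF
        refine ⟨hFK, fun F' hF' hsub => ?_⟩
        by_cases hx' : x ∈ F'
        · exfalso
          obtain ⟨hF'S, hF'N⟩ := Finset.mem_filter.1 hF'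
          obtain ⟨hFS, -⟩ := Finset.mem_filter.1 hFK
          rw [Finset.mem_powerset] at hF'S hFS
          obtain ⟨z, hzS, hzx, hzF, hz⟩ := hshed F hFS hxF' (hF'N.mono (by
            rw [← Finset.insert_union]
            exact Finset.union_subset_union_left (Finset.insert_subset hx' hsub)))
          have := hFmax (insert z F) (by
            simp only [delCpx, Finset.mem_filter, Finset.mem_powerset, Finset.insert_union,
              Finset.insert_subset_iff, Finset.mem_insert, not_or]
            exact ⟨⟨⟨hzS, hFS⟩, hz⟩, hzx.symm, hxF'⟩) (Finset.subset_insert _ _)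
          exact hzF (this ▸ Finset.mem_insert_self z F)
        · exact hFmax F' (Finset.mem_filter.2 ⟨hF', hx'⟩) hsub
    · convert hdel using 1
      ext F
      simp only [Finset.mem_filter, Finset.mem_powerset, Finset.subset_erase]
      refine ⟨fun h => ⟨⟨h.1, fun hx => hxF (h.2.mono ?_)⟩, h.2⟩, fun h => ⟨h.1.1, h.2⟩⟩
      exact Finset.insert_subset (Finset.mem_union_left _ hx) Finset.subset_union_right

end CaterpillarLayout

/-- For any finite caterpillar graph `CG` and any `r ≥ 1`, the `r`-independence complex
`Ind_r(CG)` is vertex decomposable. -/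
theorem indComplex_caterpillar_vertexDecomposable {V : Type*} [Fintype V] [DecidableEq V]
    (CG : SimpleGraph V) (hCG : IsCaterpillar CG) (r : ℕ) (hr : 1 ≤ r) :
    IsVertexDecomposable (indComplex CG r) := by
  classical
  obtain ⟨p, pos, hL⟩ := hCG.exists_layout
  convert hL.isVertexDecomposable hr _ ∅ Finset.univ rfl (Finset.disjoint_empty_left _) ?_ using 1
  · ext F
    simp [indComplex, rIndep_coe_iff]
  · intro B hB _
    simp [Finset.subset_empty.1 hB]
end

section
/- Let P_n be the path graph on vertices 1, 2, …, n with edges {i, i+1} for 1 ≤ i ≤ n − 1, and let r ≥ 1. Then the r-independence complex Ind_r(P_n) is vertex decomposable. -/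
/-- The simplicial complex on `S` whose faces are the subsets of `S` containing no member of `𝓘`. -/
def avoidingCpx {α : Type*} [DecidableEq α] (S : Finset α) (𝓘 : Finset (Finset α)) :
    Finset (Finset α) :=
  S.powerset.filter fun F => ∀ I ∈ 𝓘, ¬ I ⊆ F

section AvoidingCpx

variable {α : Type*} [DecidableEq α] {S F : Finset α} {𝓘 : Finset (Finset α)} {x : α}

theorem mem_avoidingCpx : F ∈ avoidingCpx S 𝓘 ↔ F ⊆ S ∧ ∀ I ∈ 𝓘, ¬ I ⊆ F := by
  simp [avoidingCpx]

theorem avoidingCpx_empty : avoidingCpx S ∅ = S.powerset := by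
  simp [avoidingCpx]

theorem delCpx_avoidingCpx :
    delCpx (avoidingCpx S 𝓘) x = avoidingCpx (S.erase x) (𝓘.filter fun I => x ∉ I) := by
  ext F
  simp only [delCpx, Finset.mem_filter, mem_avoidingCpx, Finset.subset_erase]
  constructor
  · rintro ⟨⟨hS, h⟩, hx⟩
    exact ⟨⟨hS, hx⟩, fun I hI => h I hI.1⟩
  · rintro ⟨⟨hS, hx⟩, h⟩
    exact ⟨⟨hS, fun I hI hIF => h I ⟨hI, fun hxI => hx (hIF hxI)⟩ hIF⟩, hx⟩

theorem linkCpx_avoidingCpx (hxS : x ∈ S) :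
    linkCpx (avoidingCpx S 𝓘) x = avoidingCpx (S.erase x) (𝓘.image fun I => I.erase x) := by
  ext F
  simp only [linkCpx, Finset.mem_filter, mem_avoidingCpx, Finset.subset_erase,
    Finset.forall_mem_image, ← Finset.subset_insert_iff, Finset.insert_subset_iff]
  constructor
  · rintro ⟨⟨hS, -⟩, hx, -, h⟩
    exact ⟨⟨hS, hx⟩, h⟩
  · rintro ⟨⟨hS, hx⟩, h⟩
    exact ⟨⟨hS, fun I hI hIF => h I hI (hIF.trans (Finset.subset_insert x F))⟩, hx, ⟨hxS, hS⟩, h⟩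

theorem delCpx_avoidingCpx_of_singleton_mem (h : {x} ∈ 𝓘) :
    delCpx (avoidingCpx S 𝓘) x = avoidingCpx S 𝓘 := by
  refine Finset.filter_true_of_mem fun F hF hx => ?_
  exact (mem_avoidingCpx.1 hF).2 _ h (Finset.singleton_subset_iff.2 hx)

end AvoidingCpx

/-- If the members of `𝓘` are intervals of `S`, the largest element of a member of `𝓘` which ends
first is a shedding vertex. -/
theorem isFacetOf_of_isFacetOf_delCpx {α : Type*} [LinearOrder α] {S I F : Finset α}
    {𝓘 : Finset (Finset α)} {x : α}
    (hsub : ∀ J ∈ 𝓘, J ⊆ S)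
    (hconv : ∀ J ∈ 𝓘, ∀ a ∈ J, ∀ b ∈ J, ∀ c ∈ S, a ≤ c → c ≤ b → c ∈ J)
    (hI : I ∈ 𝓘) (hxI : x ∈ I) (hle : ∀ y ∈ I, y ≤ x) (hmin : ∀ J ∈ 𝓘, ∃ y ∈ J, x ≤ y)
    (hF : IsFacetOf (delCpx (avoidingCpx S 𝓘) x) F) : IsFacetOf (avoidingCpx S 𝓘) F := by
  obtain ⟨hFd, hmax⟩ := hF
  simp only [delCpx, Finset.mem_filter] at hFd hmax
  obtain ⟨hFK, hxF⟩ := hFd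
  refine ⟨hFK, fun F' hF' hFF' => ?_⟩
  by_cases hxF' : x ∈ F'
  swap
  · exact hmax F' ⟨hF', hxF'⟩ hFF'
  exfalso
  rw [mem_avoidingCpx] at hFK hF'
  obtain ⟨v, hvI, hvF'⟩ := Finset.not_subset.1 (hF'.2 I hI)
  have hvx : v ≠ x := fun h => hvF' (h ▸ hxF')
  have hvF : v ∉ F := fun h => hvF' (hFF' h)
  have hxins : x ∉ insert v F := by simp [hvx.symm, hxF]
  refine hvF ?_
  rw [hmax (insert v F) ⟨mem_avoidingCpx.2 ⟨Finset.insert_subset (hsub I hI hvI) hFK.1, ?_⟩, hxins⟩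
    (Finset.subset_insert v F)]
  · exact Finset.mem_insert_self v F
  intro J hJ hJF
  have hvJ : v ∈ J := by
    by_contra hvJ
    exact hFK.2 J hJ ((Finset.subset_insert_iff_of_notMem hvJ).1 hJF)
  obtain ⟨y, hyJ, hxy⟩ := hmin J hJ
  exact hxins (hJF (hconv J hJ v hvJ y hyJ x (hsub I hI hxI) (hle v hvI) hxy))

/-- A complex whose minimal nonfaces are nonempty intervals of a linear order on the vertices is
vertex decomposable. -/
theorem isVertexDecomposable_avoidingCpx {α : Type*} [LinearOrder α] (S : Finset α)
    (𝓘 : Finset (Finset α)) (hne : ∅ ∉ 𝓘) (hsub : ∀ J ∈ 𝓘, J ⊆ S)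
    (hconv : ∀ J ∈ 𝓘, ∀ a ∈ J, ∀ b ∈ J, ∀ c ∈ S, a ≤ c → c ≤ b → c ∈ J) :
    IsVertexDecomposable (avoidingCpx S 𝓘) := by
  induction S using Finset.strongInduction generalizing 𝓘 with
  | H S ih =>
  rcases 𝓘.eq_empty_or_nonempty with rfl | h𝓘
  · rw [avoidingCpx_empty]
    exact .simplex S
  obtain ⟨I, hI, hImin⟩ := 𝓘.exists_min_image Finset.max h𝓘
  have hInon : I.Nonempty := Finset.nonempty_iff_ne_empty.2 fun h => hne (h ▸ hI)
  obtain ⟨x, hx⟩ := Finset.max_of_nonempty hInon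
  have hxI : x ∈ I := Finset.mem_of_max hx
  have hxS : x ∈ S := hsub I hI hxI
  have hmin : ∀ J ∈ 𝓘, ∃ y ∈ J, x ≤ y := fun J hJ => by
    have hJnon : J.Nonempty := Finset.nonempty_iff_ne_empty.2 fun h => hne (h ▸ hJ)
    obtain ⟨y, hy⟩ := Finset.max_of_nonempty hJnon
    refine ⟨y, Finset.mem_of_max hy, ?_⟩
    have := hImin J hJ
    rwa [hx, hy, WithBot.coe_le_coe] at this
  have hdel : IsVertexDecomposable (delCpx (avoidingCpx S 𝓘) x) := by
    rw [delCpx_avoidingCpx]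
    refine ih _ (Finset.erase_ssubset hxS) _ (fun h => hne (Finset.mem_filter.1 h).1) ?_ ?_
    · intro J hJ
      rw [Finset.mem_filter] at hJ
      exact Finset.subset_erase.2 ⟨hsub J hJ.1, hJ.2⟩
    · intro J hJ a ha b hb c hc
      exact hconv J (Finset.mem_filter.1 hJ).1 a ha b hb c (Finset.mem_of_mem_erase hc)
  by_cases hsing : {x} ∈ 𝓘
  · rwa [delCpx_avoidingCpx_of_singleton_mem hsing] at hdel
  have hvert : ∀ J ∈ 𝓘, ¬ J ⊆ {x} := fun J hJ hJx => by
    rcases Finset.subset_singleton_iff.1 hJx with rfl | rfl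
    · exact hne hJ
    · exact hsing hJ
  refine .step _ x ⟨{x}, mem_avoidingCpx.2 ⟨Finset.singleton_subset_iff.2 hxS, hvert⟩,
    Finset.mem_singleton_self x⟩ ?_ hdel fun F =>
      isFacetOf_of_isFacetOf_delCpx hsub hconv hI hxI (fun y hy => Finset.le_max_of_eq hy hx) hmin
  rw [linkCpx_avoidingCpx hxS]
  refine ih _ (Finset.erase_ssubset hxS) _ ?_ ?_ ?_
  · intro h
    obtain ⟨J, hJ, hJx⟩ := Finset.mem_image.1 h
    exact hvert J hJ (Finset.subset_singleton_iff.2 (Finset.erase_eq_empty_iff _ _ |>.1 hJx))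
  · exact Finset.forall_mem_image.2 fun J hJ => Finset.erase_subset_erase x (hsub J hJ)
  · refine Finset.forall_mem_image.2 fun J hJ a ha b hb c hc hac hcb => ?_
    rw [Finset.mem_erase] at ha hb hc ⊢
    exact ⟨hc.1, hconv J hJ a ha.2 b hb.2 c hc.2 hac hcb⟩

section PathGraph

open SimpleGraph

variable {n : ℕ} {A : Set (Fin n)}

theorem reachable_induce_pathGraph_of_Icc_subset {a b : Fin n} (hab : a ≤ b)
    (h : Set.Icc a b ⊆ A) :
    ((pathGraph n).induce A).Reachable ⟨a, h (Set.left_mem_Icc.2 hab)⟩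
      ⟨b, h (Set.right_mem_Icc.2 hab)⟩ := by
  obtain ⟨k, hk⟩ := Nat.exists_eq_add_of_le (Fin.le_def.1 hab)
  induction k generalizing b with
  | zero =>
    obtain rfl : b = a := Fin.ext hk
    rfl
  | succ k ih =>
    have hlt : a.val + k < n := by omega
    have hac : a ≤ ⟨a.val + k, hlt⟩ := Fin.le_def.2 (by simp)
    have hcb : (⟨a.val + k, hlt⟩ : Fin n) ≤ b := Fin.le_def.2 (by simp only; omega)
    refine (ih hac ((Set.Icc_subset_Icc_right hcb).trans h) rfl).trans (Adj.reachable ?_)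
    simp only [comap_adj, Function.Embedding.subtype_apply, pathGraph_adj]
    omega

theorem reachable_induce_pathGraph_of_mem_uIcc {a b : A}
    (hab : ((pathGraph n).induce A).Reachable a b) {c : Fin n} (hc : c ∈ Set.uIcc a.1 b.1) :
    ∃ h : c ∈ A, ((pathGraph n).induce A).Reachable a ⟨c, h⟩ := by
  rw [reachable_iff_reflTransGen] at hab
  induction hab with
  | refl =>
    obtain rfl : c = a := by simpa using hc
    exact ⟨a.2, .rfl⟩
  | @tail b b' hab hadj ih =>
    by_cases hcb : c = b'
    · subst hcb
      exact ⟨b'.2, ((reachable_iff_reflTransGen _ _).2 hab).trans hadj.reachable⟩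
    · refine ih ?_
      simp only [comap_adj, Function.Embedding.subtype_apply, pathGraph_adj] at hadj
      simp only [Set.mem_uIcc, Fin.le_def, Fin.ext_iff] at hc hcb ⊢
      omega

theorem rIndep_pathGraph_iff {r : ℕ} :
    rIndep (pathGraph n) r A ↔
      ∀ I : Finset (Fin n), (I : Set (Fin n)).OrdConnected → r < I.card →
        ¬ (I : Set (Fin n)) ⊆ A := by
  constructor
  · intro h I hI hr hIA
    obtain ⟨a, ha⟩ := Finset.card_pos.1 (Nat.zero_lt_of_lt hr)
    have hsub : (I : Set (Fin n)) ⊆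
        Subtype.val '' (((pathGraph n).induce A).connectedComponentMk ⟨a, hIA ha⟩).supp := by
      intro b hb
      refine ⟨⟨b, hIA hb⟩, ?_, rfl⟩
      rw [ConnectedComponent.mem_supp_iff, ConnectedComponent.eq]
      rcases le_total a b with hab | hab
      · exact (reachable_induce_pathGraph_of_Icc_subset hab ((hI.out ha hb).trans hIA)).symm
      · exact reachable_induce_pathGraph_of_Icc_subset hab ((hI.out hb ha).trans hIA)
    have hle := Set.ncard_le_ncard hsub
    rw [Set.ncard_coe_finset, Set.ncard_image_of_injective _ Subtype.val_injective] at hle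
    exact absurd (hle.trans (h _)) (not_le.2 hr)
  · intro h c
    by_contra! hc
    have hfin := Set.toFinite (Subtype.val '' c.supp)
    refine h hfin.toFinset ?_ ?_ ?_
    · rw [Set.Finite.coe_toFinset]
      refine ⟨?_⟩
      rintro _ ⟨a, ha, rfl⟩ _ ⟨b, hb, rfl⟩ d hd
      rw [ConnectedComponent.mem_supp_iff] at ha hb
      obtain ⟨hdA, had⟩ := reachable_induce_pathGraph_of_mem_uIcc
        (ConnectedComponent.eq.1 (ha.trans hb.symm)) (Set.Icc_subset_uIcc hd)
      exact ⟨⟨d, hdA⟩, (ConnectedComponent.eq.2 had.symm).trans ha, rfl⟩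
    · rwa [← Set.ncard_eq_toFinset_card _ hfin,
        Set.ncard_image_of_injective _ Subtype.val_injective]
    · rw [Set.Finite.coe_toFinset]
      exact Subtype.coe_image_subset A c.supp

open Classical in
theorem indComplex_pathGraph_eq_avoidingCpx (n r : ℕ) :
    indComplex (pathGraph n) r = avoidingCpx Finset.univ
      (Finset.univ.filter fun I : Finset (Fin n) => (I : Set (Fin n)).OrdConnected ∧ r < I.card) := by
  ext F
  simp [indComplex, mem_avoidingCpx, rIndep_pathGraph_iff]

end PathGraph

/-- For the path graph `P n` and any `r ≥ 1`, the `r`-independence complex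
`Ind_r(P n)` is vertex decomposable. -/
theorem indComplex_pathGraph_vertexDecomposable (n : ℕ) (r : ℕ) (hr : 1 ≤ r) :
    IsVertexDecomposable (indComplex (SimpleGraph.pathGraph n) r) := by
  classical
  rw [indComplex_pathGraph_eq_avoidingCpx]
  refine isVertexDecomposable_avoidingCpx _ _ ?_ ?_ ?_
  · simp
  · simp
  · intro J hJ a ha b hb c _ hac hcb
    exact (Finset.mem_filter.1 hJ).2.1.out ha hb ⟨hac, hcb⟩
end

section
/- Let r ≥ 2 and let A ⊆ V(G_r) be an r-independent set of the graph G_r with r + 1 ∈ A. Then A ∪ {1} is also r-independent. (Equivalently, the link of the vertex r + 1 in Ind_r(G_r) is a cone with apex 1.) -/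
/-- The graph `G_r` on vertices `1, …, 2r` (vertex `k+1` coded as `Sum.inl k`) and `a, b`
(coded as `Sum.inr false`, `Sum.inr true`), with edges `{i, i+1}` for `1 ≤ i ≤ r - 1` and
`r + 1 ≤ i ≤ 2r - 1`, together with `{r,a}, {r,b}, {a,b}, {a,r+1}, {b,r+1}`. -/
def Gr (r : ℕ) : SimpleGraph (Fin (2 * r) ⊕ Bool) :=
  SimpleGraph.fromRel fun u v =>
    match u, v with
    | Sum.inl k, Sum.inl m => (m : ℕ) = (k : ℕ) + 1 ∧ ((k : ℕ) + 1 < r ∨ r ≤ (k : ℕ))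
    | Sum.inl k, Sum.inr _ => (k : ℕ) = r - 1 ∨ (k : ℕ) = r
    | Sum.inr _, Sum.inl _ => False
    | Sum.inr _, Sum.inr _ => True

open SimpleGraph

/-- A set of vertices all reachable in `G[A]` from a common vertex has at most `r` elements
when `A` is `r`-independent. -/
theorem rIndep.ncard_le_of_reachable {V : Type*} [Finite V] {G : SimpleGraph V} {r : ℕ}
    {A : Set V} (hA : rIndep G r A) (v : A) (S : Set V)
    (hS : ∀ w ∈ S, ∃ hw : w ∈ A, (G.induce A).Reachable v ⟨w, hw⟩) : S.ncard ≤ r := by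
  refine le_trans ?_ (hA ((G.induce A).connectedComponentMk v))
  rw [← Set.ncard_image_of_injective _ Subtype.val_injective]
  refine Set.ncard_le_ncard (fun w hw => ?_) (Set.toFinite _)
  obtain ⟨hwA, hvw⟩ := hS w hw
  exact ⟨⟨w, hwA⟩, ConnectedComponent.sound hvw.symm, rfl⟩

/-- Adding a vertex `x` preserves `r`-independence as soon as the component of `x` in the
enlarged induced subgraph is small. -/
theorem rIndep.insert {V : Type*} [Finite V] {G : SimpleGraph V} {r : ℕ} {A : Set V}
    (hA : rIndep G r A) (x : V)
    (hx : ((G.induce (insert x A)).connectedComponentMk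
      ⟨x, Set.mem_insert x A⟩).supp.ncard ≤ r) :
    rIndep G r (insert x A) := by
  intro c
  by_cases hc : (G.induce (Insert.insert x A)).connectedComponentMk
      ⟨x, Set.mem_insert x A⟩ = c
  · exact hc ▸ hx
  have mem_of_mem : ∀ w ∈ c.supp, w.1 ∈ A := by
    rintro ⟨w, rfl | hw⟩ h
    · exact absurd h hc
    · exact hw
  obtain ⟨v, rfl⟩ := c.exists_rep
  have hv : v.1 ∈ A := mem_of_mem v rfl
  rw [← Set.ncard_image_of_injective _ Subtype.val_injective]
  refine hA.ncard_le_of_reachable ⟨v, hv⟩ _ ?_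
  rintro _ ⟨w, hw, rfl⟩
  have hvw := (reachable_iff_reflTransGen v w).1 (ConnectedComponent.exact hw).symm
  clear hw
  induction hvw with
  | refl => exact ⟨hv, Reachable.refl _⟩
  | @tail b d hvb hbd ih =>
    obtain ⟨hb, hr⟩ := ih
    have hd : d.1 ∈ A := mem_of_mem d (ConnectedComponent.sound
      (((reachable_iff_reflTransGen v b).2 hvb).trans hbd.reachable).symm)
    have hadj : (G.induce A).Adj ⟨b, hb⟩ ⟨d, hd⟩ := hbd
    exact ⟨hd, hr.trans hadj.reachable⟩

/-- The vertices `1, …, m` of `G_r`. -/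
def Gr.initialPath (r m : ℕ) : Set (Fin (2 * r) ⊕ Bool) :=
  {v | ∃ k : Fin (2 * r), (k : ℕ) < m ∧ v = Sum.inl k}

theorem Gr.ncard_initialPath_le (r m : ℕ) : (Gr.initialPath r m).ncard ≤ m := by
  have hsub : Gr.initialPath r m ⊆
      Sum.inl '' ((fun k : Fin (2 * r) => (k : ℕ)) ⁻¹' Set.Iio m) := by
    rintro _ ⟨k, hk, rfl⟩
    exact ⟨k, hk, rfl⟩
  refine (Set.ncard_le_ncard hsub (Set.toFinite _)).trans ?_
  rw [Set.ncard_image_of_injective _ Sum.inl_injective,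
    ← Set.ncard_image_of_injective _ Fin.val_injective]
  refine (Set.ncard_le_ncard (Set.image_preimage_subset _ _) (Set.finite_Iio m)).trans ?_
  simp [Set.ncard_eq_toFinset_card']

/-- If no edge of `G_r[B]` leaves `{1, …, m}` with `1 ≤ m`, then the component of `1` in
`G_r[B]` has at most `m` vertices. -/
theorem Gr.ncard_component_le {r m : ℕ} (hr : 0 < 2 * r) (hm : 0 < m)
    {B : Set (Fin (2 * r) ⊕ Bool)} (h0 : Sum.inl ⟨0, hr⟩ ∈ B)
    (hB : ∀ u ∈ Gr.initialPath r m, ∀ w ∈ B, (Gr r).Adj u w → w ∈ Gr.initialPath r m) :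
    (((Gr r).induce B).connectedComponentMk ⟨Sum.inl ⟨0, hr⟩, h0⟩).supp.ncard ≤ m := by
  refine le_trans ?_ (Gr.ncard_initialPath_le r m)
  rw [← Set.ncard_image_of_injective _ Subtype.val_injective]
  refine Set.ncard_le_ncard ?_ (Set.toFinite _)
  rintro _ ⟨w, hw, rfl⟩
  have hvw := (reachable_iff_reflTransGen _ w).1 (ConnectedComponent.exact hw).symm
  clear hw
  induction hvw with
  | refl => exact ⟨_, hm, rfl⟩
  | @tail b d _ hbd ih => exact hB _ ih _ d.2 hbd

/-- An `r`-independent set of `G_r` containing `r + 1` and `a` or `b` misses one of the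
vertices `2, …, r`. -/
theorem Gr.exists_notMem {r : ℕ} (hr : 2 ≤ r) {A : Set (Fin (2 * r) ⊕ Bool)}
    (hA : rIndep (Gr r) r A) (hlt : r < 2 * r) (h : Sum.inl ⟨r, hlt⟩ ∈ A) {x : Bool}
    (hx : Sum.inr x ∈ A) :
    ∃ k : Fin (2 * r), 0 < (k : ℕ) ∧ (k : ℕ) < r ∧ Sum.inl k ∉ A := by
  by_contra! hall
  have reach : ∀ j (hj : j < r), 0 < j →
      ∃ hw : Sum.inl ⟨r - j, by omega⟩ ∈ A,
      ((Gr r).induce A).Reachable ⟨Sum.inr x, hx⟩ ⟨Sum.inl ⟨r - j, by omega⟩, hw⟩ := by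
    intro j hj hj1
    induction j with
    | zero => omega
    | succ j ih =>
      have hmem : Sum.inl ⟨r - (j + 1), by omega⟩ ∈ A :=
        hall _ (by simp only; omega) (by simp only; omega)
      refine ⟨hmem, ?_⟩
      rcases Nat.eq_zero_or_pos j with rfl | hpos
      · refine Adj.reachable (G := (Gr r).induce A) ?_
        simp [Gr, SimpleGraph.fromRel_adj]
      · obtain ⟨hw, hreach⟩ := ih (by omega) (by omega)
        refine hreach.trans (Adj.reachable (G := (Gr r).induce A) ?_)
        simp only [Gr, SimpleGraph.comap_adj, SimpleGraph.fromRel_adj,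
          Function.Embedding.subtype_apply, ne_eq, Sum.inl.injEq, Fin.mk.injEq]
        omega
  have hsmall := hA.ncard_le_of_reachable ⟨Sum.inr x, hx⟩
    (Insert.insert (Sum.inr x) (Sum.inl '' ((fun k : Fin (2 * r) => (k : ℕ)) ⁻¹' Set.Icc 1 r)))
    (by
      rintro _ (rfl | ⟨⟨k, hk⟩, ⟨hk1, hk2⟩, rfl⟩)
      · exact ⟨hx, Reachable.refl _⟩
      · simp only at hk1 hk2
        rcases hk2.eq_or_lt with rfl | hkr
        · refine ⟨h, Adj.reachable (G := (Gr k).induce A) ?_⟩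
          simp [Gr, SimpleGraph.fromRel_adj]
        · have := reach (r - k) (by omega) (by omega)
          simpa only [Nat.sub_sub_self hk2] using this)
  rw [Set.ncard_insert_of_notMem (by simp) (Set.toFinite _),
    Set.ncard_image_of_injective _ Sum.inl_injective,
    ← Set.ncard_image_of_injective _ Fin.val_injective,
    Set.image_preimage_eq_of_subset (fun k hk => ⟨⟨k, by have := hk.2; omega⟩, rfl⟩)] at hsmall
  simp [Set.ncard_eq_toFinset_card'] at hsmall

/-- For `r ≥ 2`, if `A` is an `r`-independent set of `G_r` containing the vertex `r + 1`
(coded as `Sum.inl ⟨r, _⟩`), then `A ∪ {1}` is also `r`-independent: the link of `r + 1`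
in `Ind_r(G_r)` is a cone with apex the vertex `1` (coded as `Sum.inl ⟨0, _⟩`). -/
theorem Gr_link_cone (r : ℕ) (hr : 2 ≤ r) (A : Set (Fin (2 * r) ⊕ Bool))
    (hA : rIndep (Gr r) r A) (h : Sum.inl ⟨r, by omega⟩ ∈ A) :
    rIndep (Gr r) r (insert (Sum.inl ⟨0, by omega⟩) A) := by
  refine hA.insert _ ?_
  by_cases hab : ∃ x : Bool, Sum.inr x ∈ A
  · obtain ⟨x, hx⟩ := hab
    obtain ⟨m, hm0, hmr, hmA⟩ := Gr.exists_notMem hr hA _ h hx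
    refine (Gr.ncard_component_le (by omega) hm0 _ ?_).trans hmr.le
    rintro _ ⟨k, hk, rfl⟩ (l | y) hw hadj
    · have hlm : l ≠ m := by
        rintro rfl
        rcases hw with hw | hw
        · simp only [Sum.inl.injEq] at hw
          simp [hw] at hm0
        · exact hmA hw
      have hlm' : (l : ℕ) ≠ m := fun e => hlm (Fin.ext e)
      simp only [Gr, SimpleGraph.fromRel_adj] at hadj
      exact ⟨l, by omega, rfl⟩
    · simp only [Gr, SimpleGraph.fromRel_adj, or_false] at hadj
      have := hadj.2
      omega
  · refine Gr.ncard_component_le (by omega) (by omega) _ ?_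
    rintro _ ⟨k, hk, rfl⟩ (l | y) hw hadj
    · simp only [Gr, SimpleGraph.fromRel_adj] at hadj
      exact ⟨l, by omega, rfl⟩
    · exact absurd ⟨y, hw.resolve_left (by simp)⟩ hab
end

section
/- Let r ≥ 2 and let A ⊆ V(G_r) with r + 1 ∉ A. Then A is r-independent in G_r if and only if A ∩ ({1, …, r} ∪ {a, b}) is r-independent in G_r. (Equivalently, the r-independence complex of G_r with the vertex r + 1 deleted is the join of Ind_r(G_r[{1, …, r, a, b}]) with the full simplex on the vertex set {r+2, …, 2r}.) -/
/-- On a finite vertex set, `r`-independence passes to subsets. -/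
theorem rIndep.mono {V : Type*} [Finite V] {G : SimpleGraph V} {r : ℕ} {A B : Set V}
    (hBA : B ⊆ A) (hA : rIndep G r A) : rIndep G r B := by
  intro c
  let f : G.induce B →g G.induce A := (SimpleGraph.induceHomOfLE G hBA).toHom
  refine le_trans (Set.ncard_le_ncard_of_injOn f ?_ ?_ (Set.toFinite _)) (hA (c.map f))
  · intro v hv
    rw [SimpleGraph.ConnectedComponent.mem_supp_iff] at hv ⊢
    rw [← hv, SimpleGraph.ConnectedComponent.map_mk]
  · exact (SimpleGraph.induceHomOfLE G hBA).injective.injOn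

/-- If no edge joins `B` to `A \ B`, a walk in `G[A]` starting in `B` is a walk in `G[B]`. -/
theorem SimpleGraph.Reachable.induce_of_no_edge {V : Type*} {G : SimpleGraph V} {A B : Set V}
    (hsep : ∀ u ∈ B, ∀ v ∈ A, G.Adj u v → v ∈ B) {u v : A}
    (huv : (G.induce A).Reachable u v) (hu : (u : V) ∈ B) :
    ∃ hv : (v : V) ∈ B, (G.induce B).Reachable ⟨u, hu⟩ ⟨v, hv⟩ := by
  obtain ⟨p⟩ := huv
  induction p with
  | nil => exact ⟨hu, .refl _⟩
  | @cons x y z hxy _ ih =>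
    have hy : (y : V) ∈ B := hsep x hu y y.2 hxy
    obtain ⟨hz, hyz⟩ := ih hy
    have hadj : (G.induce B).Adj ⟨x, hu⟩ ⟨y, hy⟩ := hxy
    exact ⟨hz, hadj.reachable.trans hyz⟩

/-- If no edge joins `B` to `A \ B` and `A \ B` has at most `r` vertices, then `A` is
`r`-independent as soon as `B` is. -/
theorem rIndep.of_no_edge {V : Type*} [Finite V] {G : SimpleGraph V} {r : ℕ} {A B : Set V}
    (hsep : ∀ u ∈ B, ∀ v ∈ A, G.Adj u v → v ∈ B) (hcard : (A \ B).ncard ≤ r)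
    (hB : rIndep G r B) : rIndep G r A := by
  intro c
  by_cases hc : ∃ u ∈ c.supp, (u : V) ∈ B
  · obtain ⟨u, huc, hu⟩ := hc
    let d := (G.induce B).connectedComponentMk ⟨u, hu⟩
    refine le_trans ?_ (hB d)
    rw [← Set.ncard_image_of_injective c.supp Subtype.val_injective,
      ← Set.ncard_image_of_injective d.supp Subtype.val_injective]
    refine Set.ncard_le_ncard ?_ (Set.toFinite _)
    rintro _ ⟨v, hvc, rfl⟩
    rw [SimpleGraph.ConnectedComponent.mem_supp_iff] at huc hvc
    obtain ⟨hv, huv⟩ := (SimpleGraph.ConnectedComponent.exact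
      (huc.trans hvc.symm)).induce_of_no_edge hsep hu
    exact ⟨⟨v, hv⟩, SimpleGraph.ConnectedComponent.sound huv.symm, rfl⟩
  · push Not at hc
    refine le_trans ?_ hcard
    rw [← Set.ncard_image_of_injective c.supp Subtype.val_injective]
    refine Set.ncard_le_ncard ?_ (Set.toFinite _)
    rintro _ ⟨v, hv, rfl⟩
    exact ⟨v.2, hc v hv⟩

/-- For `r ≥ 2` and `A ⊆ V(G_r)` not containing the vertex `r + 1` (coded as
`Sum.inl ⟨r, _⟩`), `A` is `r`-independent in `G_r` iff `A ∩ ({1, …, r} ∪ {a, b})` is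
`r`-independent in `G_r`: deleting the vertex `r + 1` from `Ind_r(G_r)` yields the join of
`Ind_r(G_r[{1, …, r, a, b}])` with the full simplex on `{r+2, …, 2r}`. -/
theorem Gr_del_join (r : ℕ) (hr : 2 ≤ r) (A : Set (Fin (2 * r) ⊕ Bool))
    (h : Sum.inl ⟨r, by omega⟩ ∉ A) :
    rIndep (Gr r) r A ↔
      rIndep (Gr r) r
        (A ∩ {v | Sum.elim (fun k : Fin (2 * r) => (k : ℕ) < r) (fun _ => True) v}) := by
  refine ⟨rIndep.mono Set.inter_subset_left, rIndep.of_no_edge ?_ ?_⟩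
  · rintro u ⟨-, hu⟩ v hv huv
    refine ⟨hv, ?_⟩
    rcases v with m | b
    · have hm : (m : ℕ) ≠ r := by
        rintro hmr
        exact h (by convert hv; exact hmr.symm)
      rcases u with k | b <;> simp [Gr] at hu huv ⊢ <;> omega
    · trivial
  · have hsub : A \ (A ∩ {v | Sum.elim (fun k : Fin (2 * r) => (k : ℕ) < r)
        (fun _ => True) v}) ⊆ Set.range fun i : Fin r => Sum.inl ⟨r + i, by omega⟩ := by
      rintro (k | b) ⟨hA, hk⟩
      · have hk' : r ≤ (k : ℕ) := by simpa [hA] using hk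
        exact ⟨⟨k - r, by omega⟩, by simp [Fin.ext_iff]; omega⟩
      · exact absurd ⟨hA, trivial⟩ hk
    refine (Set.ncard_le_ncard hsub (Set.toFinite _)).trans ?_
    rw [← Set.image_univ]
    exact (Set.ncard_image_le (Set.toFinite _)).trans (by simp [Set.ncard_univ])
end

section
/- Let r ≥ 2 and let F = {1, …, r−1} ∪ {r+2, …, 2r} ⊆ V(G_r). A subset A ⊆ V(G_r) with F ⊆ A and |A| = 2r is r-independent in G_r if and only if A = F ∪ {r, r+1} or A = F ∪ {a, b}. In particular, exactly two faces of maximal cardinality 2r of Ind_r(G_r) contain F, and the two corresponding complementary pairs {r, r+1} and {a, b} are disjoint. -/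
/-- A set is `r`-independent if some labelling is constant along its edges and each label
class injects into `{0, …, r - 1}`. -/
theorem rIndep_of_labelling {V κ : Type*} {G : SimpleGraph V} {r : ℕ} {A : Set V}
    (c : V → κ) (g : V → ℕ) (hc : ∀ u ∈ A, ∀ v ∈ A, G.Adj u v → c u = c v)
    (hg : ∀ v, g v < r) (hinj : ∀ u v, c u = c v → g u = g v → u = v) :
    rIndep G r A := by
  intro C
  have hreach : ∀ u v : A, (G.induce A).Reachable u v → c u = c v := by
    rintro u v ⟨p⟩
    induction p with
    | nil => rfl
    | cons h _ ih => exact (hc _ (Subtype.prop _) _ (Subtype.prop _) h).trans ih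
  have hle := Set.ncard_le_ncard_of_injOn (s := C.supp) (t := ↑(Finset.range r))
    (fun v => g v) (fun v _ => by simpa using hg v)
    (fun u hu v hv h => Subtype.ext (hinj _ _
      (hreach _ _ (SimpleGraph.ConnectedComponent.exact (Eq.trans hu (Eq.symm hv)))) h))
    (Finset.finite_toSet _)
  simpa only [Set.ncard_coe_finset, Finset.card_range] using hle

/-- A set containing the vertices of a path on `r + 1` vertices is not `r`-independent. -/
theorem not_rIndep_of_path {V : Type*} [Finite V] {G : SimpleGraph V} {r : ℕ} {A : Set V}
    (f : ℕ → V) (hmem : ∀ i ≤ r, f i ∈ A) (hadj : ∀ i < r, G.Adj (f i) (f (i + 1)))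
    (hinj : ∀ i ≤ r, ∀ j ≤ r, f i = f j → i = j) : ¬ rIndep G r A := by
  intro h
  have hreach : ∀ i (hi : i ≤ r),
      (G.induce A).Reachable ⟨f i, hmem i hi⟩ ⟨f 0, hmem 0 (Nat.zero_le r)⟩ := by
    intro i
    induction i with
    | zero => exact fun _ => SimpleGraph.Reachable.refl _
    | succ i ih =>
      intro hi
      refine SimpleGraph.Reachable.trans (SimpleGraph.Adj.reachable ?_) (ih (by omega))
      exact (hadj i (by omega)).symm
  have hle := h ((G.induce A).connectedComponentMk ⟨f 0, hmem 0 (Nat.zero_le r)⟩)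
  have hlt := Set.ncard_le_ncard_of_injOn (s := (Set.univ : Set (Fin (r + 1))))
    (t := ((G.induce A).connectedComponentMk ⟨f 0, hmem 0 (Nat.zero_le r)⟩).supp)
    (fun i => ⟨f i, hmem i (by omega)⟩)
    (fun i _ => SimpleGraph.ConnectedComponent.sound (hreach i (by omega)))
    (fun i _ j _ hij => Fin.ext (hinj i (by omega) j (by omega) (congrArg Subtype.val hij)))
    (Set.toFinite _)
  simp only [Set.ncard_univ, Nat.card_eq_fintype_card, Fintype.card_fin] at hlt
  omega

theorem Gr_adj_inl_inl {r : ℕ} {k m : Fin (2 * r)} :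
    (Gr r).Adj (Sum.inl k) (Sum.inl m) ↔
      ((m : ℕ) = k + 1 ∧ ((k : ℕ) + 1 < r ∨ r ≤ k)) ∨
      ((k : ℕ) = m + 1 ∧ ((m : ℕ) + 1 < r ∨ r ≤ m)) := by
  simp only [Gr, SimpleGraph.fromRel_adj, ne_eq, Sum.inl.injEq, Fin.ext_iff]
  omega

theorem Gr_adj_inl_inr {r : ℕ} {k : Fin (2 * r)} {x : Bool} :
    (Gr r).Adj (Sum.inl k) (Sum.inr x) ↔ (k : ℕ) = r - 1 ∨ (k : ℕ) = r := by
  simp [Gr, SimpleGraph.fromRel_adj]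

/-- A set containing all `Sum.inl k` with `k ∉ {r - 1, r}` is `r`-independent in `G_r` as soon
as, and only if, it has no edge between the two path ends and `a, b`. -/
theorem rIndep_Gr_iff {r : ℕ} (hr : 2 ≤ r) {A : Set (Fin (2 * r) ⊕ Bool)}
    (hA : ∀ k : Fin (2 * r), (k : ℕ) < r - 1 ∨ r + 1 ≤ (k : ℕ) → Sum.inl k ∈ A) :
    rIndep (Gr r) r A ↔
      ∀ k : Fin (2 * r), ∀ x : Bool, Sum.inl k ∈ A → Sum.inr x ∈ A →
        (k : ℕ) ≠ r - 1 ∧ (k : ℕ) ≠ r := by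
  constructor
  · intro h k x hk hx
    constructor
    · intro hkr
      refine not_rIndep_of_path
        (fun i => if hi : i < r then Sum.inl ⟨i, by omega⟩ else Sum.inr x) ?_ ?_ ?_ h
      · intro i _
        split_ifs with hi
        · by_cases hik : i = k
          · subst hik; exact hk
          · exact hA _ (Or.inl (show i < r - 1 by omega))
        · exact hx
      · intro i hi
        by_cases hi' : i + 1 < r
        · rw [dif_pos hi, dif_pos hi', Gr_adj_inl_inl]
          dsimp only
          omega
        · simp only [hi, hi', dif_pos, dif_neg, not_false_eq_true, Gr_adj_inl_inr]; omega
      · intro i _ j _ hij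
        split_ifs at hij <;> simp_all <;> omega
    · intro hkr
      refine not_rIndep_of_path
        (fun i => if hi : i < r then Sum.inl ⟨2 * r - 1 - i, by omega⟩ else Sum.inr x) ?_ ?_ ?_ h
      · intro i _
        split_ifs with hi
        · by_cases hik : 2 * r - 1 - i = k
          · simpa only [hik] using hk
          · exact hA _ (Or.inr (show r + 1 ≤ 2 * r - 1 - i by omega))
        · exact hx
      · intro i hi
        by_cases hi' : i + 1 < r
        · rw [dif_pos hi, dif_pos hi', Gr_adj_inl_inl]
          dsimp only
          omega
        · simp only [hi, hi', dif_pos, dif_neg, not_false_eq_true, Gr_adj_inl_inr]; omega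
      · intro i _ j _ hij
        split_ifs at hij <;> simp_all <;> omega
  · intro h
    refine rIndep_of_labelling
      (Sum.elim (fun k => if (k : ℕ) < r then 0 else 1) (fun _ => 2))
      (Sum.elim (fun k => if (k : ℕ) < r then (k : ℕ) else k - r) Bool.toNat) ?_ ?_ ?_
    · rintro (k | x) hu (m | y) hv huv
      · rw [Gr_adj_inl_inl] at huv
        simp only [Sum.elim_inl]
        split_ifs <;> omega
      · have := h k y hu hv
        rw [Gr_adj_inl_inr] at huv
        omega
      · have := h m x hv hu
        rw [SimpleGraph.adj_comm, Gr_adj_inl_inr] at huv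
        omega
      · rfl
    · rintro (k | x)
      · simp only [Sum.elim_inl]
        split_ifs <;> omega
      · have := x.toNat_lt
        simp only [Sum.elim_inr]
        omega
    · rintro (k | x) (m | y) huv hg
      · simp only [Sum.elim_inl] at huv hg
        refine congrArg Sum.inl (Fin.ext ?_)
        split_ifs at huv hg <;> omega
      · simp only [Sum.elim_inl, Sum.elim_inr] at huv
        split_ifs at huv <;> omega
      · simp only [Sum.elim_inl, Sum.elim_inr] at huv
        split_ifs at huv <;> omega
      · exact congrArg Sum.inr (by cases x <;> cases y <;> simp_all)

/-- For `r ≥ 2`, let `F = {1, …, r-1} ∪ {r+2, …, 2r}` (in the coding, `Sum.inl k` for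
`k < r - 1` or `r + 1 ≤ k`).  A set `A` with `F ⊆ A` and `|A| = 2r` is `r`-independent in
`G_r` iff `A = F ∪ {r, r+1}` or `A = F ∪ {a, b}`: exactly two faces of maximal cardinality
`2r` of `Ind_r(G_r)` contain `F`, and the complementary pairs `{r, r+1}` and `{a, b}` are
disjoint. -/
theorem Gr_two_facets_over_F (r : ℕ) (hr : 2 ≤ r)
    (F A : Finset (Fin (2 * r) ⊕ Bool))
    (hF : F = (Finset.univ.filter
        fun k : Fin (2 * r) => (k : ℕ) < r - 1 ∨ r + 1 ≤ (k : ℕ)).image Sum.inl)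
    (hFA : F ⊆ A) (hA : A.card = 2 * r) :
    rIndep (Gr r) r ↑A ↔
      A = F ∪ {Sum.inl ⟨r - 1, by omega⟩, Sum.inl ⟨r, by omega⟩} ∨
      A = F ∪ {Sum.inr false, Sum.inr true} := by
  have memF : ∀ k : Fin (2 * r),
      Sum.inl k ∈ F ↔ ((k : ℕ) < r - 1 ∨ r + 1 ≤ (k : ℕ)) := by
    intro k; simp [hF]
  have memF' : ∀ x : Bool, Sum.inr x ∉ F := by
    intro x; simp [hF]
  have hcard : F.card ≤ 2 * r - 2 := by
    have hne : (⟨r - 1, by omega⟩ : Fin (2 * r)) ≠ ⟨r, by omega⟩ := by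
      simp only [ne_eq, Fin.mk.injEq]; omega
    have hsub : F ⊆ (({⟨r - 1, by omega⟩, ⟨r, by omega⟩}ᶜ : Finset (Fin (2 * r))).image
        Sum.inl) := by
      rw [hF]
      refine Finset.image_subset_image fun k hk => ?_
      simp only [Finset.mem_filter, Finset.mem_univ, true_and] at hk
      simp only [Finset.mem_compl, Finset.mem_insert, Finset.mem_singleton, Fin.ext_iff]
      omega
    refine (Finset.card_le_card hsub).trans (Finset.card_image_le.trans ?_)
    rw [Finset.card_compl, Finset.card_pair hne, Fintype.card_fin]
  have heq : ∀ u v, A ⊆ F ∪ {u, v} → A = F ∪ {u, v} := fun u v h =>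
    Finset.eq_of_subset_of_card_le h <| by
      have h1 := Finset.card_union_le F {u, v}
      have h2 := Finset.card_le_two (a := u) (b := v)
      omega
  rw [rIndep_Gr_iff hr fun k hk => Finset.mem_coe.mpr (hFA ((memF k).mpr hk))]
  simp only [Finset.mem_coe]
  constructor
  · intro h
    by_cases hx : ∃ x : Bool, Sum.inr x ∈ A
    · obtain ⟨x, hx⟩ := hx
      refine Or.inr (heq _ _ ?_)
      rintro (k | y) hk
      · have := h k x hk hx
        exact Finset.mem_union_left _ ((memF k).mpr (by omega))
      · cases y <;> simp
    · refine Or.inl (heq _ _ ?_)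
      rintro (k | y) hk
      · simp only [Finset.mem_union, memF, Finset.mem_insert, Finset.mem_singleton,
          Sum.inl.injEq, Fin.ext_iff]
        omega
      · exact absurd ⟨y, hk⟩ hx
  · rintro (h | h) k x hk hx
    · simp [h, memF'] at hx
    · simp only [h, Finset.mem_union, memF, Finset.mem_insert, Finset.mem_singleton,
        reduceCtorEq, or_false] at hk
      omega
end
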